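/- arXiv:2601.11226 — 3 statements merged into one kernel-verified Lean document; each statement's English description precedes it below -/
import Mathlib

section
/- The sequence {p(n)^(1/n)}_{n≥6} is strictly decreasing, where p(n) is the number of partitions of n. Equivalently, p(n)^(n+1) > p(n+1)^n for all n ≥ 6. -/
open Nat

namespace Nat.Partition

/-- The partitions of `n` without parts equal to `1`. -/
def withoutOnes (n : ℕ) : Finset n.Partition := Finset.univ.filter fun l => 1 ∉ l.parts

theorem card_succ (n : ℕ) :
    Fintype.card (n + 1).Partition = Fintype.card n.Partition + (withoutOnes (n + 1)).card := by
  have h := Fintype.card_congr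
    (partitionWithPartEquiv (n := n + 1) (a := 1) le_rfl (Nat.le_add_left 1 n))
  rw [Fintype.card_subtype] at h
  rw [show Fintype.card n.Partition = Fintype.card (n + 1 - 1).Partition from rfl, ← h,
    withoutOnes, Finset.card_filter_add_card_filter_not, Finset.card_univ]

theorem card_mono : Monotone fun n : ℕ => Fintype.card n.Partition :=
  monotone_nat_of_le_succ fun n => by rw [card_succ]; exact Nat.le_add_right _ _

theorem card_pos (n : ℕ) : 0 < Fintype.card n.Partition := Fintype.card_pos

/-- Replace one part `s` by `s - 1` ones. -/
def shred {n : ℕ} (l : (n + 1).Partition) (s : ℕ) (hs : s ∈ l.parts) : n.Partition where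
  parts := l.parts.erase s + Multiset.replicate (s - 1) 1
  parts_pos {i} hi := by
    rcases Multiset.mem_add.1 hi with h | h
    · exact l.parts_pos (Multiset.mem_of_mem_erase h)
    · rw [Multiset.eq_of_mem_replicate h]; exact one_pos
  parts_sum := by
    have h1 := Multiset.sum_erase hs
    have h2 := l.parts_pos hs
    rw [l.parts_sum] at h1
    simp only [Multiset.sum_add, Multiset.sum_replicate, smul_eq_mul, mul_one]
    omega

theorem sum_card_toFinset_withoutOnes_le (n : ℕ) :
    ∑ l ∈ withoutOnes (n + 1), l.parts.toFinset.card ≤ Fintype.card n.Partition := by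
  rw [← Finset.card_sigma, ← Finset.card_univ]
  refine Finset.card_le_card_of_injOn
    (fun a => if h : a.2 ∈ a.1.parts then shred a.1 a.2 h else default)
    (fun _ _ => Finset.mem_coe.2 (Finset.mem_univ _)) ?_
  rintro ⟨l, s⟩ hl ⟨m, t⟩ hm h
  simp only [Finset.coe_sigma, Set.mem_sigma_iff, Finset.mem_coe, withoutOnes,
    Finset.mem_filter, Finset.mem_univ, true_and, Multiset.mem_toFinset] at hl hm
  simp only [hl.2, hm.2, dite_true] at h
  have h' : l.parts.erase s + Multiset.replicate (s - 1) 1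
      = m.parts.erase t + Multiset.replicate (t - 1) 1 := congrArg Partition.parts h
  have hc := congrArg (Multiset.count 1) h'
  have h1 : Multiset.count 1 (l.parts.erase s) = 0 :=
    Multiset.count_eq_zero.2 fun h => hl.1 (Multiset.mem_of_mem_erase h)
  have h2 : Multiset.count 1 (m.parts.erase t) = 0 :=
    Multiset.count_eq_zero.2 fun h => hm.1 (Multiset.mem_of_mem_erase h)
  rw [Multiset.count_add, Multiset.count_add, Multiset.count_replicate_self,
    Multiset.count_replicate_self, h1, h2] at hc
  have hs := l.parts_pos hl.2
  have ht := m.parts_pos hm.2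
  obtain rfl : s = t := by omega
  have h3 : l.parts = m.parts := by
    rw [← Multiset.cons_erase hl.2, ← Multiset.cons_erase hm.2, add_right_cancel h']
  obtain rfl : l = m := Partition.ext h3
  rfl

theorem card_sub_mul_le (n j s : ℕ) (hs : 0 < s) (h : j * s ≤ n) :
    Fintype.card (n - j * s).Partition ≤
      (Finset.univ.filter fun l : n.Partition => j ≤ l.parts.count s).card := by
  rw [← Finset.card_univ]
  refine Finset.card_le_card_of_injOn
    (fun m => ⟨m.parts + Multiset.replicate j s, fun {i} hi => ?_, ?_⟩) ?_ ?_
  · rcases Multiset.mem_add.1 hi with h | h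
    · exact m.parts_pos h
    · rwa [Multiset.eq_of_mem_replicate h]
  · simp only [Multiset.sum_add, m.parts_sum, Multiset.sum_replicate, smul_eq_mul]
    omega
  · intro m _
    simp
  · intro l _ m _ h
    exact Partition.ext (add_right_cancel (congrArg Partition.parts h))

/-- A lower bound from the recurrence `n * p n = ∑ s * p (n - j * s)`. -/
theorem sum_mul_card_le (n J : ℕ) :
    ∑ j ∈ Finset.Icc 1 J, ∑ s ∈ (Finset.Icc 1 n).filter (fun s => j * s ≤ n),
      s * Fintype.card (n - j * s).Partition ≤ n * Fintype.card n.Partition := by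
  calc _ ≤ ∑ j ∈ Finset.Icc 1 J, ∑ s ∈ Finset.Icc 1 n,
        s * (Finset.univ.filter fun l : n.Partition => j ≤ l.parts.count s).card := by
        refine Finset.sum_le_sum fun j _ => (Finset.sum_le_sum fun s hs => ?_).trans
          (Finset.sum_le_sum_of_subset (Finset.filter_subset _ _))
        rw [Finset.mem_filter, Finset.mem_Icc] at hs
        exact Nat.mul_le_mul_left _ (card_sub_mul_le n j s hs.1.1 hs.2)
    _ = ∑ l : n.Partition, ∑ s ∈ Finset.Icc 1 n,
          s * ((Finset.Icc 1 J).filter fun j => j ≤ l.parts.count s).card := by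
        simp_rw [Finset.card_filter, Finset.mul_sum]
        rw [Finset.sum_comm]
        simp_rw [Finset.sum_comm (s := Finset.Icc 1 J)]
        rw [Finset.sum_comm]
    _ ≤ ∑ l : n.Partition, n := by
        refine Finset.sum_le_sum fun l _ => ?_
        calc _ ≤ ∑ s ∈ Finset.Icc 1 n, s * l.parts.count s := by
              refine Finset.sum_le_sum fun s _ => Nat.mul_le_mul_left _ ?_
              calc _ ≤ (Finset.Icc 1 (l.parts.count s)).card := Finset.card_le_card fun j hj => by
                    simp only [Finset.mem_filter, Finset.mem_Icc] at hj ⊢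
                    exact ⟨hj.1.1, hj.2⟩
                _ = _ := by simp
          _ = l.parts.sum := by
              rw [Finset.sum_multiset_count_of_subset l.parts (Finset.Icc 1 n) fun s hs => by
                rw [Multiset.mem_toFinset] at hs
                exact Finset.mem_Icc.2 ⟨l.parts_pos hs, le_of_mem_parts hs⟩]
              exact Finset.sum_congr rfl fun s _ => by rw [smul_eq_mul, mul_comm]
          _ = n := l.parts_sum
    _ = _ := by rw [Finset.sum_const, Finset.card_univ, smul_eq_mul, mul_comm]

theorem sum_pow_card_toFinset_mul_pow_le (n : ℕ) {u x : ℝ} (hu : 0 ≤ u) (hx : 0 ≤ x) (hx1 : x < 1) :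
    (∑ l : n.Partition, u ^ l.parts.toFinset.card) * x ^ n ≤
      ∏ k ∈ Finset.Icc 1 n, (1 + u * (x ^ k / (1 - x ^ k))) := by
  have key : ∀ l : n.Partition, u ^ l.parts.toFinset.card * x ^ n =
      ∏ k ∈ Finset.Icc 1 n, ((if l.parts.count k = 0 then 1 else u) * (x ^ k) ^ l.parts.count k) := by
    intro l
    have hsub : l.parts.toFinset ⊆ Finset.Icc 1 n := fun s hs => by
      rw [Multiset.mem_toFinset] at hs
      exact Finset.mem_Icc.2 ⟨l.parts_pos hs, le_of_mem_parts hs⟩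
    rw [Finset.prod_mul_distrib]
    congr 1
    · rw [← Finset.prod_subset hsub, Finset.prod_congr rfl (g := fun _ => u), Finset.prod_const]
      · intro k hk
        rw [if_neg]
        simpa [Multiset.count_eq_zero] using hk
      · intro k _ hk
        rw [if_pos]
        simpa [Multiset.count_eq_zero] using hk
    · simp_rw [← pow_mul]
      rw [Finset.prod_pow_eq_pow_sum]
      congr 1
      conv_lhs => rw [← l.parts_sum, Finset.sum_multiset_count_of_subset l.parts _ hsub]
      exact Finset.sum_congr rfl fun s _ => by rw [smul_eq_mul, mul_comm]
  have hinj : Function.Injective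
      (fun (l : n.Partition) (k : ℕ) (_ : k ∈ Finset.Icc 1 n) => l.parts.count k) := by
    intro l m h
    refine Partition.ext (Multiset.ext.2 fun k => ?_)
    by_cases hk : k ∈ Finset.Icc 1 n
    · exact congrFun (congrFun h k) hk
    · rw [Multiset.count_eq_zero.2, Multiset.count_eq_zero.2]
      · exact fun hs => hk (Finset.mem_Icc.2 ⟨m.parts_pos hs, le_of_mem_parts hs⟩)
      · exact fun hs => hk (Finset.mem_Icc.2 ⟨l.parts_pos hs, le_of_mem_parts hs⟩)
  have hpow : ∀ k ∈ Finset.Icc 1 n, 0 ≤ x ^ k ∧ x ^ k < 1 := fun k hk =>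
    ⟨pow_nonneg hx k, pow_lt_one₀ hx hx1 (Nat.pos_iff_ne_zero.1 (Finset.mem_Icc.1 hk).1)⟩
  calc _ = ∑ l : n.Partition, ∏ k ∈ (Finset.Icc 1 n).attach,
          ((if l.parts.count k.1 = 0 then 1 else u) * (x ^ k.1) ^ l.parts.count k.1) := by
        rw [Finset.sum_mul]
        refine Finset.sum_congr rfl fun l _ => ?_
        rw [key, Finset.prod_attach (Finset.Icc 1 n) fun k =>
          (if l.parts.count k = 0 then 1 else u) * (x ^ k) ^ l.parts.count k]
    _ ≤ ∑ f ∈ (Finset.Icc 1 n).pi fun _ => Finset.range (n + 1), ∏ k ∈ (Finset.Icc 1 n).attach,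
          ((if f k.1 k.2 = 0 then 1 else u) * (x ^ k.1) ^ f k.1 k.2) := by
        rw [← Finset.sum_image (s := Finset.univ) (g := fun (l : n.Partition) (k : ℕ)
          (_ : k ∈ Finset.Icc 1 n) => l.parts.count k) (f := fun f =>
            ∏ k ∈ (Finset.Icc 1 n).attach, ((if f k.1 k.2 = 0 then 1 else u) *
              (x ^ k.1) ^ f k.1 k.2)) fun _ _ _ _ h => hinj h]
        refine Finset.sum_le_sum_of_subset_of_nonneg ?_ ?_
        · intro f hf
          obtain ⟨l, -, rfl⟩ := Finset.mem_image.1 hf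
          refine Finset.mem_pi.2 fun k hk => Finset.mem_range.2 (Nat.lt_succ_of_le ?_)
          have h1 : l.parts.count k * k ≤ n := by
            obtain ⟨m, hm⟩ := Multiset.le_iff_exists_add.1
              (Multiset.le_count_iff_replicate_le.1 (le_refl (l.parts.count k)))
            have h := congrArg Multiset.sum hm
            rw [l.parts_sum, Multiset.sum_add, Multiset.sum_replicate, smul_eq_mul] at h
            omega
          exact (Nat.le_mul_of_pos_right _ (Finset.mem_Icc.1 hk).1).trans h1
        · intro f _ _
          refine Finset.prod_nonneg fun k _ => mul_nonneg ?_ (pow_nonneg (pow_nonneg hx _) _)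
          split_ifs
          exacts [zero_le_one, hu]
    _ = ∏ k ∈ Finset.Icc 1 n, ∑ j ∈ Finset.range (n + 1),
          ((if j = 0 then 1 else u) * (x ^ k) ^ j) := by
        rw [Finset.prod_sum]
    _ ≤ _ := by
        refine Finset.prod_le_prod (fun k _ => Finset.sum_nonneg fun j _ => mul_nonneg ?_
          (pow_nonneg (pow_nonneg hx _) _)) fun k hk => ?_
        · split_ifs
          exacts [zero_le_one, hu]
        · rw [Finset.sum_range_succ']
          obtain ⟨h0, h1⟩ := hpow k hk
          simp only [Nat.add_eq_zero_iff, one_ne_zero, and_false, if_false, if_true, pow_zero,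
            mul_one]
          rw [add_comm, ← Finset.mul_sum]
          simp_rw [pow_succ]
          rw [← Finset.sum_mul, geom_sum_eq h1.ne]
          gcongr
          rw [div_mul_eq_mul_div, ← neg_div_neg_eq, neg_sub]
          have h2 : 0 ≤ (x ^ k) ^ n := pow_nonneg h0 _
          have h3 : 0 < 1 - x ^ k := by linarith
          gcongr
          nlinarith [mul_nonneg h2 h0, mul_nonneg (mul_nonneg h2 h0) h0]

open PowerSeries PowerSeries.WithPiTopology in
theorem mk_card_mul_pentagonalSeries :
    (PowerSeries.mk fun n => (Fintype.card n.Partition : ℤ)) * pentagonalSeries ℤ = 1 := by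
  let _ : TopologicalSpace ℤ := ⊥
  have _ : DiscreteTopology ℤ := ⟨rfl⟩
  have h1 := hasProd_powerSeriesMk_card_restricted ℤ fun _ => True
  have h2 := h1.mul (PowerSeries.WithPiTopology.hasProd_one_sub_X_pow ℤ)
  have h3 : ∀ i : ℕ, (∑' j : ℕ, (X : PowerSeries ℤ) ^ ((i + 1) * j)) * (1 - X ^ (i + 1)) = 1 := by
    intro i
    simp_rw [pow_mul]
    exact tsum_pow_mul_one_sub_of_constantCoeff_eq_zero (by simp)
  simp only [if_true, h3] at h2
  have h4 := h2.unique hasProd_one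
  simpa [restricted] using h4

/-- The truncated pentagonal series, as a polynomial. -/
noncomputable def pentagonalPoly (K : ℕ) : Polynomial ℤ :=
  ∑ k ∈ Finset.range K, (-1) ^ k * (Polynomial.X ^ (k * (3 * k + 1) / 2) -
    Polynomial.X ^ ((k + 1) * (3 * k + 2) / 2))

theorem pentagonal_neg_natCast (k : ℕ) : pentagonal (-(k : ℤ)) = k * (3 * k + 1) / 2 := by
  have h := two_mul_natCast_pentagonal_neg (k : ℤ)
  norm_cast at h
  omega

theorem pentagonal_natCast_add_one (k : ℕ) :
    pentagonal ((k : ℤ) + 1) = (k + 1) * (3 * k + 2) / 2 := by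
  have h := two_mul_natCast_pentagonal ((k : ℤ) + 1)
  rw [show ((k : ℤ) + 1) * (3 * (k + 1) - 1) = (((k + 1) * (3 * k + 2) : ℕ) : ℤ) by
    push_cast; ring] at h
  generalize pentagonal ((k : ℤ) + 1) = a at h ⊢
  norm_cast at h
  omega

open scoped PowerSeries.WithPiTopology in
theorem coeff_pentagonalPoly {K n : ℕ} (h : n < K * (3 * K + 1) / 2) :
    (pentagonalPoly K).coeff n = (PowerSeries.pentagonalSeries ℤ).coeff n := by
  let _ : TopologicalSpace ℤ := ⊥
  have _ : DiscreteTopology ℤ := ⟨rfl⟩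
  have h1 := (PowerSeries.WithPiTopology.hasSum_pow_pentagonal_sub_pentagonalSeries ℤ).map
    (PowerSeries.coeff n) (PowerSeries.WithPiTopology.continuous_coeff ℤ n)
  have h2 : ∀ k, k ∉ Finset.range K → (PowerSeries.coeff (R := ℤ) n ∘ fun k : ℕ => (-1) ^ k *
      (PowerSeries.X ^ pentagonal (-(k : ℤ)) - PowerSeries.X ^ pentagonal ((k : ℤ) + 1))) k = 0 := by
    intro k hk
    rw [Finset.mem_range, not_lt] at hk
    have h3 : K * (3 * K + 1) / 2 ≤ k * (3 * k + 1) / 2 := by gcongr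
    have h4 : k * (3 * k + 1) / 2 ≤ (k + 1) * (3 * k + 2) / 2 := by gcongr <;> omega
    simp only [Function.comp_apply, pentagonal_neg_natCast, pentagonal_natCast_add_one]
    rw [show ((-1 : PowerSeries ℤ) ^ k) = PowerSeries.C ((-1) ^ k) by simp,
      PowerSeries.coeff_C_mul, map_sub, PowerSeries.coeff_X_pow, PowerSeries.coeff_X_pow,
      if_neg (by omega), if_neg (by omega)]
    simp
  rw [← (hasSum_sum_of_ne_finset_zero h2).unique h1, pentagonalPoly, Polynomial.finsetSum_coeff]
  refine Finset.sum_congr rfl fun k _ => ?_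
  simp only [Function.comp_apply, pentagonal_neg_natCast, pentagonal_natCast_add_one]
  rw [show ((-1 : PowerSeries ℤ) ^ k) = PowerSeries.C ((-1) ^ k) by simp,
    show ((-1 : Polynomial ℤ) ^ k) = Polynomial.C ((-1) ^ k) by simp,
    PowerSeries.coeff_C_mul, Polynomial.coeff_C_mul, map_sub, Polynomial.coeff_sub,
    PowerSeries.coeff_X_pow, PowerSeries.coeff_X_pow, Polynomial.coeff_X_pow,
    Polynomial.coeff_X_pow]

theorem pow_dvd_sum_card_mul_eval_sub_one {K N : ℕ} (h : N ≤ K * (3 * K + 1) / 2) (B : ℤ) :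
    B ^ N ∣ (∑ n ∈ Finset.range N, (Fintype.card n.Partition : ℤ) * B ^ n) *
      (pentagonalPoly K).eval B - 1 := by
  have h1 : Polynomial.X ^ N ∣ PowerSeries.trunc N
      (PowerSeries.mk fun n => (Fintype.card n.Partition : ℤ)) * pentagonalPoly K - 1 := by
    rw [Polynomial.X_pow_dvd_iff]
    intro d hd
    rw [Polynomial.coeff_sub, sub_eq_zero, Polynomial.coeff_mul, Polynomial.coeff_one,
      ← PowerSeries.coeff_one, ← mk_card_mul_pentagonalSeries, PowerSeries.coeff_mul]
    refine Finset.sum_congr rfl fun a ha => ?_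
    have ha := Finset.HasAntidiagonal.mem_antidiagonal.1 ha
    rw [PowerSeries.coeff_trunc, if_pos (by omega), coeff_pentagonalPoly (by omega)]
  have h2 := Polynomial.eval_dvd (x := B) h1
  rw [Polynomial.eval_sub, Polynomial.eval_mul, Polynomial.eval_pow, Polynomial.eval_X,
    Polynomial.eval_one, Polynomial.eval, PowerSeries.eval₂_trunc_eq_sum_range] at h2
  simpa using h2

theorem sum_range_mul_pow_lt {f : ℕ → ℕ} {B : ℕ} (N : ℕ) (hf : ∀ n < N, f n < B) :
    ∑ n ∈ Finset.range N, f n * B ^ n < B ^ N := by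
  induction N with
  | zero => simp
  | succ N ih =>
    rw [Finset.sum_range_succ, pow_succ]
    have h1 := ih fun n hn => hf n (by omega)
    have h2 : (f N + 1) * B ^ N ≤ B * B ^ N := Nat.mul_le_mul_right _ (hf N (by omega))
    nlinarith

theorem sum_range_mul_pow_div_mod {f : ℕ → ℕ} {B : ℕ} {N n : ℕ} (hn : n < N)
    (hf : ∀ n < N, f n < B) : (∑ n ∈ Finset.range N, f n * B ^ n) / B ^ n % B = f n := by
  obtain ⟨m, rfl⟩ : ∃ m, N = n + 1 + m := ⟨N - (n + 1), by omega⟩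
  have hB : 0 < B := (Nat.zero_le _).trans_lt (hf n hn)
  have h1 := sum_range_mul_pow_lt n fun i hi => hf i (by omega)
  have h2 : ∑ i ∈ Finset.range (n + 1 + m), f i * B ^ i = ∑ i ∈ Finset.range n, f i * B ^ i +
      B ^ n * (f n + B * ∑ i ∈ Finset.range m, f (n + 1 + i) * B ^ i) := by
    rw [Finset.sum_range_add, Finset.sum_range_succ, mul_add, add_assoc, mul_comm (f n),
      Finset.mul_sum, Finset.mul_sum]
    congr 2
    exact Finset.sum_congr rfl fun i _ => by ring
  rw [h2, Nat.add_mul_div_left _ _ (pow_pos hB n), Nat.div_eq_of_lt h1, zero_add,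
    Nat.add_mul_mod_self_left, Nat.mod_eq_of_lt (hf n hn)]

/-- The values of the terms of `pentagonalPoly K` with sign `(-1) ^ b` at `B`. -/
def pentagonalSum (B : ℕ) (b : Bool) : ℕ → ℕ
  | 0 => 0
  | k + 1 => pentagonalSum B b k + cond (b == (k % 2 == 0))
      (B ^ ((k + 1) * (3 * k + 2) / 2)) (B ^ (k * (3 * k + 1) / 2))

theorem eval_pentagonalPoly (B K : ℕ) :
    (pentagonalPoly K).eval (B : ℤ) = pentagonalSum B false K - pentagonalSum B true K := by
  induction K with
  | zero => simp [pentagonalPoly, pentagonalSum]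
  | succ k ih =>
    have h : pentagonalPoly (k + 1) = pentagonalPoly k + (-1) ^ k *
        (Polynomial.X ^ (k * (3 * k + 1) / 2) - Polynomial.X ^ ((k + 1) * (3 * k + 2) / 2)) :=
      Finset.sum_range_succ _ _
    rw [h, Polynomial.eval_add, ih]
    rcases Nat.even_or_odd k with hk | hk
    · simp [pentagonalSum, hk.neg_one_pow, Nat.even_iff.1 hk]
      ring
    · simp [pentagonalSum, hk.neg_one_pow, Nat.odd_iff.1 hk]
      ring

/-- An inverse of the pentagonal series determines the partition numbers. -/
theorem eq_sum_card_mul_pow {K N B T : ℕ} (h : N ≤ K * (3 * K + 1) / 2)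
    (hB : ∀ n < N, Fintype.card n.Partition < B) (hT : T < B ^ N)
    (h1 : pentagonalSum B false K * T % B ^ N = (pentagonalSum B true K * T + 1) % B ^ N) :
    T = ∑ n ∈ Finset.range N, Fintype.card n.Partition * B ^ n := by
  set A := ∑ n ∈ Finset.range N, Fintype.card n.Partition * B ^ n with hA
  have hdvd := pow_dvd_sum_card_mul_eval_sub_one h (B : ℤ)
  rw [eval_pentagonalPoly] at hdvd
  set e := (pentagonalSum B false K : ℤ) - pentagonalSum B true K with he
  have h2 : ((B : ℤ) ^ N) ∣ e * T - 1 := by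
    have h3 : (pentagonalSum B true K * T + 1) ≡ pentagonalSum B false K * T [MOD B ^ N] := h1.symm
    have h4 := (Nat.modEq_iff_dvd).1 h3
    push_cast at h4
    rwa [he, sub_mul, sub_sub]
  have h5 : ((B : ℤ) ^ N) ∣ (A : ℤ) * e - 1 := by rw [hA]; push_cast; exact hdvd
  have h6 : ((B : ℤ) ^ N) ∣ (A : ℤ) - T := by
    have : (A : ℤ) - T = T * (A * e - 1) - A * (e * T - 1) := by ring
    rw [this]
    exact _root_.dvd_sub (h5.mul_left (T : ℤ)) (h2.mul_left (A : ℤ))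
  have h7 : T ≡ A [MOD B ^ N] := (Nat.modEq_iff_dvd).2 (by push_cast; exact h6)
  exact h7.eq_of_lt_of_lt hT (sum_range_mul_pow_lt N hB)

/-- Evaluate `f n` after reducing `n` to a literal. -/
def withValue (n : ℕ) (f : ℕ → Bool) : Bool :=
  match n with
  | 0 => f 0
  | k + 1 => f (k + 1)

theorem withValue_eq (n : ℕ) (f : ℕ → Bool) : withValue n f = f n := by
  cases n <;> rfl

/-- Apply `f` to the result of `k` Newton steps towards an inverse of `U` modulo `M`. -/
def withNewton (M U : ℕ) (f : ℕ → Bool) : ℕ → ℕ → Bool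
  | 0, T => f T
  | k + 1, T => withValue (T * (2 + M - U * T % M) % M) (withNewton M U f k)

theorem exists_of_withNewton {M U : ℕ} {f : ℕ → Bool} {k T : ℕ}
    (h : withNewton M U f k T = true) : ∃ T, f T = true := by
  induction k generalizing T with
  | zero => exact ⟨T, h⟩
  | succ k ih =>
    rw [withNewton, withValue_eq] at h
    exact ih h

/-- Check `a (n + 1) ^ n < a n ^ (n + 1)` for `k` consecutive `n`, where `T = ∑ a (n + i) B ^ i`. -/
def checkRoots (B : ℕ) : ℕ → ℕ → ℕ → Bool
  | 0, _, _ => true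
  | k + 1, n, T => withValue (T / B) fun S =>
      Nat.blt ((S % B) ^ n) ((T % B) ^ (n + 1)) && checkRoots B k (n + 1) S

theorem of_checkRoots {B k n T : ℕ} (h : checkRoots B k n T = true) {i : ℕ} (hi : i < k) :
    (T / B ^ (i + 1) % B) ^ (n + i) < (T / B ^ i % B) ^ (n + i + 1) := by
  induction k generalizing n T i with
  | zero => omega
  | succ k ih =>
    rw [checkRoots, withValue_eq, Bool.and_eq_true, Nat.blt_eq] at h
    cases i with
    | zero => simpa using h.1
    | succ i =>
      have := ih h.2 (i := i) (by omega)
      rwa [Nat.div_div_eq_div_mul, Nat.div_div_eq_div_mul, ← pow_succ', ← pow_succ',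
        add_assoc n, add_comm 1 i] at this

/-- Check lower bounds for the base `B` digits of `T` in positions `c ^ 2 / 100`, for `c < k`. -/
def checkLower (B T : ℕ) : ℕ → Bool
  | 0 => true
  | c + 1 => Nat.ble (12713 ^ (c + 1)) (210 * (T / B ^ (c ^ 2 / 100) % B) * 10000 ^ (c + 1)) &&
      checkLower B T c

theorem of_checkLower {B T k : ℕ} (h : checkLower B T k = true) {c : ℕ} (hc : c < k) :
    12713 ^ (c + 1) ≤ 210 * (T / B ^ (c ^ 2 / 100) % B) * 10000 ^ (c + 1) := by
  induction k with
  | zero => omega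
  | succ k ih =>
    rw [checkLower, Bool.and_eq_true, Nat.ble_eq] at h
    rcases Nat.lt_succ_iff_lt_or_eq.1 hc with h1 | rfl
    · exact ih h.2 h1
    · exact h.1

/-- The verification that `T` encodes the numbers of partitions of `n ≤ 2500` in base `B`. -/
def checkTable (B M T : ℕ) : Bool :=
  Nat.blt T M &&
    Nat.beq (pentagonalSum B false 41 * T % M) ((pentagonalSum B true 41 * T + 1) % M) &&
    checkRoots B 2494 6 (T / B ^ 6) && checkLower B T 501

/-- Compute the table of partition numbers by Newton iteration and check it. -/
def checkAll (B : ℕ) : Bool :=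
  withValue (B ^ 2501) fun M =>
    withValue ((pentagonalSum B false 41 + M - pentagonalSum B true 41) % M) fun U =>
      withNewton M U (checkTable B M) 12 1

set_option maxRecDepth 100000 in
theorem checkAll_eq_true : checkAll (2 ^ 192) = true := by
  decide +kernel

theorem card_bounds_of_lt (hB : ∀ n < 2501, Fintype.card n.Partition < 2 ^ 192) :
    (∀ n, 6 ≤ n → n < 2500 →
      Fintype.card (n + 1).Partition ^ n < Fintype.card n.Partition ^ (n + 1)) ∧
    ∀ c ≤ 500, 12713 ^ (c + 1) ≤
      210 * Fintype.card (c ^ 2 / 100).Partition * 10000 ^ (c + 1) := by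
  have h := checkAll_eq_true
  generalize 2 ^ 192 = B at h hB
  rw [checkAll, withValue_eq, withValue_eq] at h
  obtain ⟨T, hT⟩ := exists_of_withNewton h
  simp only [checkTable, Bool.and_eq_true, Nat.blt_eq, Nat.beq_eq] at hT
  obtain ⟨⟨⟨h1, h2⟩, h3⟩, h4⟩ := hT
  have hsum := eq_sum_card_mul_pow (K := 41) (N := 2501) (by norm_num) hB h1 h2
  have hdig : ∀ n < 2501, T / B ^ n % B = Fintype.card n.Partition := fun n hn => by
    rw [hsum]; exact sum_range_mul_pow_div_mod hn hB
  constructor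
  · intro n hn hn1
    obtain ⟨i, rfl⟩ := Nat.exists_eq_add_of_le hn
    have h5 := of_checkRoots h3 (i := i) (by omega)
    rwa [Nat.div_div_eq_div_mul, Nat.div_div_eq_div_mul, ← pow_add, ← pow_add, ← add_assoc 6,
      hdig _ (by omega), hdig _ (by omega)] at h5
  · intro c hc
    have h5 := of_checkLower h4 (c := c) (by omega)
    have h6 : c ^ 2 / 100 < 2501 := by
      have : c ^ 2 ≤ 500 ^ 2 := Nat.pow_le_pow_left hc 2
      omega
    rwa [hdig _ h6] at h5

section Analysis

theorem sum_exp_neg_mul_le {s : ℝ} (hs : 0 < s) (n : ℕ) :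
    ∑ k ∈ Finset.Icc 1 n, Real.exp (-s) ^ k ≤ 1 / s := by
  set y := Real.exp (-s) with hy
  have h1 : (∑ k ∈ Finset.Icc 1 n, y ^ k) * (1 - y) = y - y ^ (n + 1) := by
    induction n with
    | zero => simp
    | succ n ih =>
      rw [Finset.sum_Icc_succ_top (by omega), add_mul, ih]
      ring
  have h2 : 0 < y := Real.exp_pos _
  have h3 : y * (1 + s) ≤ 1 := by
    calc y * (1 + s) ≤ y * Real.exp s := by
          gcongr
          linarith [Real.add_one_le_exp s]
      _ = 1 := by rw [hy, ← Real.exp_add]; simp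
  have h4 : 0 ≤ y ^ (n + 1) := by positivity
  have h5 : 0 < 1 - y := by
    have : y < 1 := Real.exp_lt_one_iff.2 (by linarith)
    linarith
  rw [le_div_iff₀ hs]
  refine le_of_mul_le_mul_right ?_ h5
  calc _ = s * (y - y ^ (n + 1)) := by rw [← h1]; ring
    _ ≤ _ := by nlinarith

/-- The coefficients of the expansion of `log ((1 - v * q) / (1 - q)) ` in `q`. -/
theorem hasSum_log_ratio {v q : ℝ} (hv : 0 ≤ v) (hv1 : v < 1) (hq : 0 ≤ q) (hq1 : q < 1) :
    HasSum (fun i : ℕ => (1 - v ^ (i + 1)) / (i + 1) * q ^ (i + 1))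
      (Real.log (1 + (1 - v) * (q / (1 - q)))) := by
  have hvq : v * q < 1 := by nlinarith
  have h1 := Real.hasSum_pow_div_log_of_abs_lt_one (x := q) (by rwa [abs_of_nonneg hq])
  have h2 := Real.hasSum_pow_div_log_of_abs_lt_one (x := v * q)
    (by rwa [abs_of_nonneg (mul_nonneg hv hq)])
  have h3 : 0 < 1 - q := by linarith
  have h4 : 1 + (1 - v) * (q / (1 - q)) = (1 - v * q) / (1 - q) := by field_simp; ring
  rw [h4, Real.log_div (by linarith) h3.ne']
  rw [show Real.log (1 - v * q) - Real.log (1 - q) =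
    -Real.log (1 - q) - -Real.log (1 - v * q) by ring]
  refine (h1.sub h2).congr_fun fun i => ?_
  rw [mul_pow]
  ring

theorem hasSum_one_sub_pow_div_sq {v : ℝ} (hv : 0 ≤ v) (hv1 : v < 1) (N : ℕ) :
    ∃ A ≤ Real.pi ^ 2 / 6 - ∑ i ∈ Finset.range N, v ^ (i + 1) / ((i : ℝ) + 1) ^ 2,
      HasSum (fun i : ℕ => (1 - v ^ (i + 1)) / ((i : ℝ) + 1) ^ 2) A := by
  have h1 : HasSum (fun i : ℕ => 1 / ((i : ℝ) + 1) ^ 2) (Real.pi ^ 2 / 6) := by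
    have := (hasSum_nat_add_iff' (f := fun n : ℕ => 1 / (n : ℝ) ^ 2) 1).2 hasSum_zeta_two
    simpa using this
  have h2 : Summable fun i : ℕ => v ^ (i + 1) / ((i : ℝ) + 1) ^ 2 := by
    refine Summable.of_nonneg_of_le (fun i => by positivity) (fun i => ?_) h1.summable
    gcongr
    exact pow_le_one₀ hv hv1.le
  refine ⟨_, ?_, (h1.sub h2.hasSum).congr_fun ?_⟩
  · exact sub_le_sub_left (h2.sum_le_tsum _ fun i _ => by positivity) _
  · intro i
    rw [sub_div]

theorem prod_le_exp {v t : ℝ} (hv : 0 ≤ v) (hv1 : v < 1) (ht : 0 < t) (n N : ℕ) :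
    ∏ k ∈ Finset.Icc 1 n,
      (1 + (1 - v) * (Real.exp (-t) ^ k / (1 - Real.exp (-t) ^ k))) ≤
    Real.exp ((Real.pi ^ 2 / 6 -
      ∑ i ∈ Finset.range N, v ^ (i + 1) / ((i : ℝ) + 1) ^ 2) / t) := by
  obtain ⟨A, hA, hsum⟩ := hasSum_one_sub_pow_div_sq hv hv1 N
  have hq : ∀ k ∈ Finset.Icc 1 n, 0 ≤ Real.exp (-t) ^ k ∧ Real.exp (-t) ^ k < 1 := fun k hk =>
    ⟨by positivity, pow_lt_one₀ (Real.exp_pos _).le (Real.exp_lt_one_iff.2 (by linarith))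
      (Nat.pos_iff_ne_zero.1 (Finset.mem_Icc.1 hk).1)⟩
  have hpos : ∀ k ∈ Finset.Icc 1 n,
      0 < 1 + (1 - v) * (Real.exp (-t) ^ k / (1 - Real.exp (-t) ^ k)) := fun k hk => by
    obtain ⟨h0, h1⟩ := hq k hk
    have h2 : 0 < 1 - Real.exp (-t) ^ k := by linarith
    have h3 : 0 < 1 - v := by linarith
    positivity
  rw [← Real.log_le_iff_le_exp (Finset.prod_pos hpos), Real.log_prod fun k hk => (hpos k hk).ne']
  refine le_trans ?_ (div_le_div_of_nonneg_right hA ht.le)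
  refine hasSum_le (fun i => ?_)
    (hasSum_sum fun k hk => hasSum_log_ratio hv hv1 (hq k hk).1 (hq k hk).2) (hsum.div_const t)
  have h1 := sum_exp_neg_mul_le (s := t * (i + 1)) (by positivity) n
  have h2 : ∀ k : ℕ, (Real.exp (-t) ^ k) ^ (i + 1) = Real.exp (-(t * (i + 1))) ^ k := fun k => by
    rw [← Real.exp_nat_mul, ← Real.exp_nat_mul, ← Real.exp_nat_mul]
    push_cast
    ring_nf
  have h3 : 0 ≤ 1 - v ^ (i + 1) := sub_nonneg.2 (pow_le_one₀ hv hv1.le)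
  simp_rw [h2]
  rw [← Finset.mul_sum]
  calc _ ≤ (1 - v ^ (i + 1)) / (i + 1) * (1 / (t * (i + 1))) := by gcongr
    _ = _ := by field_simp

theorem sum_pow_card_toFinset_le {v t : ℝ} (hv : 0 ≤ v) (hv1 : v < 1) (ht : 0 < t) (n N : ℕ) :
    ∑ l : n.Partition, (1 - v) ^ l.parts.toFinset.card ≤
    Real.exp (t * n + (Real.pi ^ 2 / 6 -
      ∑ i ∈ Finset.range N, v ^ (i + 1) / ((i : ℝ) + 1) ^ 2) / t) := by
  have h1 := (sum_pow_card_toFinset_mul_pow_le n (sub_nonneg.2 hv1.le) (Real.exp_pos (-t)).le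
    (Real.exp_lt_one_iff.2 (by linarith))).trans (prod_le_exp hv hv1 ht n N)
  have h2 : Real.exp (t * n) * Real.exp (-t) ^ n = 1 := by
    rw [← Real.exp_nat_mul, ← Real.exp_add, Real.exp_eq_one_iff]
    ring
  rw [Real.exp_add]
  calc _ = Real.exp (t * n) *
        ((∑ l : n.Partition, (1 - v) ^ l.parts.toFinset.card) * Real.exp (-t) ^ n) := by
        linear_combination (-∑ l : n.Partition, (1 - v) ^ l.parts.toFinset.card) * h2
    _ ≤ _ := by gcongr

theorem card_lt_two_pow {n : ℕ} (hn : n < 2501) : Fintype.card n.Partition < 2 ^ 192 := by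
  have h1 := sum_pow_card_toFinset_le (v := 0) (t := 1 / 40) le_rfl one_pos (by norm_num) 2500 0
  simp only [sub_zero, one_pow, Finset.sum_const, Finset.card_univ, nsmul_eq_mul, mul_one,
    Finset.range_zero, Finset.sum_empty] at h1
  have h2 : (Fintype.card (Nat.Partition 2500) : ℝ) < 2 ^ 192 := by
    refine h1.trans_lt ?_
    rw [← Real.lt_log_iff_exp_lt (by positivity), Real.log_pow]
    have h3 := Real.log_two_gt_d9
    have h4 := Real.pi_lt_d2
    have h5 : Real.pi ^ 2 < 9.9225 := by nlinarith [Real.pi_gt_three]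
    norm_num
    linarith
  exact (card_mono (Nat.le_of_lt_succ hn)).trans_lt (by exact_mod_cast h2)

end Analysis

section LowerBound

theorem hasSum_pow_three_mul_geometric {q : ℝ} (hq : 0 ≤ q) (hq1 : q < 1) :
    HasSum (fun s : ℕ => (s : ℝ) ^ 3 * q ^ s)
      (q / (1 - q) ^ 2 + 6 * (q / (1 - q) ^ 2) ^ 2) := by
  have hn : ‖q‖ < 1 := by rwa [Real.norm_of_nonneg hq]
  have h0 := hasSum_choose_mul_geometric_of_norm_lt_one 0 hn
  have h1 := hasSum_choose_mul_geometric_of_norm_lt_one 1 hn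
  have h2 := hasSum_choose_mul_geometric_of_norm_lt_one 2 hn
  have h3 := hasSum_choose_mul_geometric_of_norm_lt_one 3 hn
  have h4 : 1 - q ≠ 0 := by linarith
  have h := (((h3.mul_left 6).sub (h2.mul_left 12)).add (h1.mul_left 7)).sub h0
  rw [show q / (1 - q) ^ 2 + 6 * (q / (1 - q) ^ 2) ^ 2 =
    6 * (1 / (1 - q) ^ (3 + 1)) - 12 * (1 / (1 - q) ^ (2 + 1)) + 7 * (1 / (1 - q) ^ (1 + 1)) -
      1 / (1 - q) ^ (0 + 1) by field_simp; ring]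
  refine h.congr_fun fun s => ?_
  have e2 : ((s : ℝ) + 1) * (s + 2) = 2 * (s + 2).choose 2 := by
    have := Nat.ascFactorial_eq_factorial_mul_choose s 2
    simp only [Nat.ascFactorial, Nat.factorial] at this
    have := congrArg (Nat.cast (R := ℝ)) this
    push_cast at this
    linarith
  have e3 : ((s : ℝ) + 1) * (s + 2) * (s + 3) = 6 * (s + 3).choose 3 := by
    have := Nat.ascFactorial_eq_factorial_mul_choose s 3
    simp only [Nat.ascFactorial, Nat.factorial] at this
    have := congrArg (Nat.cast (R := ℝ)) this
    push_cast at this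
    linarith
  simp only [Nat.choose_zero_right, Nat.choose_one_right]
  push_cast
  linear_combination q ^ s * (e3 - 6 * e2)

theorem exp_neg_div_sq_le {y : ℝ} (hy : 0 < y) :
    Real.exp (-y) / (1 - Real.exp (-y)) ^ 2 ≤ 1 / y ^ 2 := by
  have h1 : y / 2 ≤ Real.sinh (y / 2) := Real.self_le_sinh_iff.2 (by linarith)
  have h2 : Real.exp (-y) * (2 * Real.sinh (y / 2)) ^ 2 = (1 - Real.exp (-y)) ^ 2 := by
    have e1 : Real.exp (-y) = Real.exp (-(y / 2)) ^ 2 := by rw [← Real.exp_nat_mul]; ring_nf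
    have e2 : Real.exp (-(y / 2)) * Real.exp (y / 2) = 1 := by rw [← Real.exp_add]; simp
    rw [Real.sinh_eq, e1]
    linear_combination
      (Real.exp (-(y / 2)) * Real.exp (y / 2) + 1 - 2 * Real.exp (-(y / 2)) ^ 2) * e2
  have h3 : Real.exp (-y) < 1 := Real.exp_lt_one_iff.2 (by linarith)
  have h4 : 0 < (1 - Real.exp (-y)) ^ 2 := pow_pos (by linarith) 2
  rw [div_le_div_iff₀ h4 (by positivity), ← h2, one_mul]
  gcongr
  linarith

theorem le_exp_neg_div_sq {y : ℝ} (hy : 0 < y) :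
    1 / y ^ 2 - 1 / 2 ≤ Real.exp (-y) / (1 - Real.exp (-y)) ^ 2 := by
  rcases le_or_gt 1 (y ^ 2 / 2) with hw | hw
  · have h1 : 1 / y ^ 2 ≤ 1 / 2 := one_div_le_one_div_of_le two_pos (by linarith)
    have : 0 ≤ Real.exp (-y) / (1 - Real.exp (-y)) ^ 2 := by positivity
    linarith
  · have h1 := Real.cosh_le_exp_half_sq y
    have h2 : Real.exp (y ^ 2 / 2) * (1 - y ^ 2 / 2) ≤ 1 := by
      calc _ ≤ Real.exp (y ^ 2 / 2) * Real.exp (-(y ^ 2 / 2)) := by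
            gcongr
            linarith [Real.add_one_le_exp (-(y ^ 2 / 2))]
        _ = 1 := by rw [← Real.exp_add]; simp
    have h3 : Real.exp (-y) * (2 * Real.cosh y - 2) = (1 - Real.exp (-y)) ^ 2 := by
      have e2 : Real.exp (-y) * Real.exp y = 1 := by rw [← Real.exp_add]; simp
      rw [Real.cosh_eq]
      linear_combination e2
    have h4 : Real.exp (-y) < 1 := Real.exp_lt_one_iff.2 (by linarith)
    have h5 : 0 < (1 - Real.exp (-y)) ^ 2 := pow_pos (by linarith) 2
    have h6 : 0 < y ^ 2 := by positivity
    rw [le_div_iff₀ h5, ← h3, show 1 / y ^ 2 - 1 / 2 = (1 - y ^ 2 / 2) / y ^ 2 by field_simp,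
      div_mul_eq_mul_div, div_le_iff₀ h6]
    have h7 : (1 - y ^ 2 / 2) * (2 * Real.cosh y - 2) ≤ y ^ 2 := by nlinarith
    have h8 := Real.exp_pos (-y)
    nlinarith

theorem sub_sub_le_sqrt {Y k : ℝ} (hY : 0 < Y) (hk : 0 ≤ k) (hkn : k ≤ Y ^ 2) :
    Y - k / (2 * Y) - k ^ 2 / (2 * Y ^ 3) ≤ √(Y ^ 2 - k) := by
  refine (le_abs_self _).trans (Real.abs_le_sqrt ?_)
  obtain ⟨x, rfl⟩ : ∃ x, k = x * Y ^ 2 := ⟨k / Y ^ 2, by field_simp⟩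
  have h1 : 0 < Y ^ 2 := by positivity
  have hx : 0 ≤ x := nonneg_of_mul_nonneg_left hk h1
  have hx1 : x ≤ 1 := by nlinarith
  have h2 : Y - x * Y ^ 2 / (2 * Y) - (x * Y ^ 2) ^ 2 / (2 * Y ^ 3) =
      Y * (1 - x / 2 - x ^ 2 / 2) := by field_simp
  rw [h2, mul_pow, show Y ^ 2 - x * Y ^ 2 = Y ^ 2 * (1 - x) by ring]
  gcongr
  have h3 : x ^ 2 * (3 - 2 * x - x ^ 2) ≥ 0 := mul_nonneg (sq_nonneg x) (by nlinarith)
  nlinarith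

theorem exp_mul_le_exp_sqrt {Y t k : ℝ} (hY : 0 < Y) (ht : 0 < t) (hk : 0 ≤ k)
    (hkn : k ≤ Y ^ 2) :
    Real.exp (2 * t * Y * Y) * (Real.exp (-(t * k)) * (1 - t * k ^ 2 / Y ^ 2)) ≤
      Real.exp (2 * t * Y * √(Y ^ 2 - k)) := by
  calc _ ≤ Real.exp (2 * t * Y * Y) *
        (Real.exp (-(t * k)) * Real.exp (-(t * k ^ 2 / Y ^ 2))) := by
        gcongr
        linarith [Real.add_one_le_exp (-(t * k ^ 2 / Y ^ 2))]
    _ = Real.exp (2 * t * Y * (Y - k / (2 * Y) - k ^ 2 / (2 * Y ^ 3))) := by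
        rw [← Real.exp_add, ← Real.exp_add]
        congr 1
        field_simp
        ring
    _ ≤ _ := by
        gcongr
        exact sub_sub_le_sqrt hY hk hkn

theorem le_sum_mul_exp {t : ℝ} {n j : ℕ} (ht : 0 < t) (hj : 0 < j) (hn : 0 < n)
    (htn : 1 ≤ t * n) :
    1 / (j ^ 2 * t ^ 2) - 1 / 2 - (1 / (t * n) + 6 / (j ^ 2 * t ^ 3 * n)) ≤
    ∑ s ∈ (Finset.Icc 1 n).filter (fun s => j * s ≤ n),
      s * (Real.exp (-(t * (j * s))) * (1 - t * (j * s) ^ 2 / n)) := by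
  have hj' : (0 : ℝ) < j := Nat.cast_pos.2 hj
  have hn' : (0 : ℝ) < n := Nat.cast_pos.2 hn
  have hy : 0 < j * t := by positivity
  set q := Real.exp (-(j * t)) with hq
  have hq0 : 0 ≤ q := (Real.exp_pos _).le
  have hq1 : q < 1 := Real.exp_lt_one_iff.2 (by linarith)
  have h1 := hasSum_coe_mul_geometric_of_norm_lt_one
    (show ‖q‖ < 1 by rwa [Real.norm_of_nonneg hq0])
  have h3 := hasSum_pow_three_mul_geometric hq0 hq1
  have hu := exp_neg_div_sq_le hy
  have hl := le_exp_neg_div_sq hy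
  rw [← hq] at hu hl
  set Z := q / (1 - q) ^ 2 with hZ
  have hZ0 : 0 ≤ Z := by positivity
  have h : HasSum (fun s : ℕ => -(s * (Real.exp (-(t * (j * s))) * (1 - t * (j * s) ^ 2 / n))))
      (-(Z - t * j ^ 2 / n * (Z + 6 * Z ^ 2))) := by
    refine (h1.sub (h3.mul_left (t * j ^ 2 / n))).neg.congr_fun fun s => ?_
    rw [show Real.exp (-(t * (j * s))) = q ^ s by rw [hq, ← Real.exp_nat_mul]; ring_nf]
    ring
  have h4 := sum_le_hasSum ((Finset.Icc 1 n).filter (fun s => j * s ≤ n)) (fun s hs => ?_) h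
  · rw [Finset.sum_neg_distrib, neg_le_neg_iff] at h4
    refine le_trans ?_ h4
    have h5 : t * j ^ 2 / n * (Z + 6 * Z ^ 2) ≤
        t * j ^ 2 / n * (1 / (j * t) ^ 2 + 6 * (1 / (j * t) ^ 2) ^ 2) := by gcongr
    have h6 : t * j ^ 2 / n * (1 / (j * t) ^ 2 + 6 * (1 / (j * t) ^ 2) ^ 2) =
      1 / (t * n) + 6 / (j ^ 2 * t ^ 3 * n) := by field_simp
    rw [← mul_pow]
    linarith
  · rcases Nat.eq_zero_or_pos s with rfl | hs0
    · simp
    · have h7 : n < j * s := by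
        by_contra h8
        refine hs (Finset.mem_filter.2 ⟨Finset.mem_Icc.2 ⟨hs0, ?_⟩, not_lt.1 h8⟩)
        exact (Nat.le_mul_of_pos_left s hj).trans (not_lt.1 h8)
      have h8 : (n : ℝ) ≤ j * s := by exact_mod_cast h7.le
      have h9 : 1 ≤ t * (j * s) ^ 2 / n := by
        rw [le_div_iff₀ hn', one_mul]
        calc (n : ℝ) ≤ (t * n) * n := by nlinarith
          _ = t * n ^ 2 := by ring
          _ ≤ _ := by gcongr
      rw [neg_nonneg]
      exact mul_nonpos_of_nonneg_of_nonpos (by positivity)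
        (mul_nonpos_of_nonneg_of_nonpos (by positivity) (by linarith))

theorem exp_sqrt_le_of_forall_lt {n : ℕ} (hn : 2500 ≤ n) {C : ℝ}
    (ih : ∀ m < n, Real.exp (2.4 * √m) ≤ C * Fintype.card m.Partition) :
    Real.exp (2.4 * √n) ≤ C * Fintype.card n.Partition := by
  have hn0 : (2500 : ℝ) ≤ n := by exact_mod_cast hn
  have hC : 0 < C := by
    have := (Real.exp_pos _).trans_le (ih 0 (by omega))
    exact pos_of_mul_pos_left this (Nat.cast_nonneg _)
  set Y := √(n : ℝ) with hY
  have hYn : Y ^ 2 = n := Real.sq_sqrt (by linarith)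
  have hY50 : 50 ≤ Y := Real.le_sqrt_of_sq_le (by linarith)
  have hY0 : 0 < Y := by linarith
  set t := 1.2 / Y with ht
  have ht0 : 0 < t := by positivity
  have htY : 2 * t * Y = 2.4 := by rw [ht]; field_simp; norm_num
  have htn : 1 ≤ t * n := by
    rw [← hYn, show t * Y ^ 2 = 2 * t * Y * Y / 2 by ring, htY]
    linarith
  set E := Real.exp (2.4 * Y) with hE
  have key : E * ∑ j ∈ Finset.Icc (1 : ℕ) 40,
      (1 / ((j : ℝ) ^ 2 * t ^ 2) - 1 / 2 - (1 / (t * n) + 6 / (j ^ 2 * t ^ 3 * n))) ≤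
      n * (C * Fintype.card n.Partition) := by
    calc _ ≤ E * ∑ j ∈ Finset.Icc (1 : ℕ) 40, ∑ s ∈ (Finset.Icc 1 n).filter (fun s => j * s ≤ n),
          (s : ℝ) * (Real.exp (-(t * (j * s))) * (1 - t * (j * s) ^ 2 / n)) := by
          gcongr with j hj
          exact le_sum_mul_exp ht0 (Finset.mem_Icc.1 hj).1 (by omega) htn
      _ ≤ ∑ j ∈ Finset.Icc (1 : ℕ) 40, ∑ s ∈ (Finset.Icc 1 n).filter (fun s => j * s ≤ n),
          C * ((s * Fintype.card (n - j * s).Partition : ℕ) : ℝ) := by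
          rw [Finset.mul_sum]
          refine Finset.sum_le_sum fun j hj => ?_
          rw [Finset.mul_sum]
          refine Finset.sum_le_sum fun s hs => ?_
          rw [Finset.mem_filter, Finset.mem_Icc] at hs
          have hj1 := (Finset.mem_Icc.1 hj).1
          have h1 : 0 < j * s := Nat.mul_pos hj1 hs.1.1
          have h2 := ih (n - j * s) (by omega)
          have h3 : ((j : ℝ) * s) ≤ Y ^ 2 := by rw [hYn]; exact_mod_cast hs.2
          have h4 := exp_mul_le_exp_sqrt hY0 ht0 (k := j * s) (by positivity) h3
          rw [htY, hYn] at h4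
          rw [Nat.cast_sub hs.2, Nat.cast_mul] at h2
          calc _ = (s : ℝ) *
                (E * (Real.exp (-(t * (j * s))) * (1 - t * (j * s) ^ 2 / n))) := by ring
            _ ≤ s * (C * Fintype.card (n - j * s).Partition) := by
                exact mul_le_mul_of_nonneg_left (h4.trans h2) (Nat.cast_nonneg _)
            _ = _ := by push_cast; ring
      _ = C * ((∑ j ∈ Finset.Icc (1 : ℕ) 40, ∑ s ∈ (Finset.Icc 1 n).filter (fun s => j * s ≤ n),
          s * Fintype.card (n - j * s).Partition : ℕ) : ℝ) := by
          push_cast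
          simp_rw [Finset.mul_sum]
      _ ≤ C * ((n * Fintype.card n.Partition : ℕ) : ℝ) := by
          gcongr
          exact sum_mul_card_le n 40
      _ = _ := by push_cast; ring
  have hS : (n : ℝ) ≤ ∑ j ∈ Finset.Icc (1 : ℕ) 40,
      (1 / ((j : ℝ) ^ 2 * t ^ 2) - 1 / 2 - (1 / (t * n) + 6 / (j ^ 2 * t ^ 3 * n))) := by
    have h1 : ∀ j ∈ Finset.Icc (1 : ℕ) 40,
        (1 / ((j : ℝ) ^ 2 * t ^ 2) - 1 / 2 - (1 / (t * n) + 6 / (j ^ 2 * t ^ 3 * n))) =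
        (Y ^ 2 / 1.44 - 6 * Y / 1.728) * (1 / (j : ℝ) ^ 2) - (1 / 2 + 1 / (1.2 * Y)) := by
      intro j hj
      have hj' : (0 : ℝ) < j := Nat.cast_pos.2 (Finset.mem_Icc.1 hj).1
      rw [← hYn, ht]
      field_simp
      ring
    rw [Finset.sum_congr rfl h1, Finset.sum_sub_distrib, ← Finset.mul_sum, Finset.sum_const]
    have h2 : (1.62 : ℝ) ≤ ∑ j ∈ Finset.Icc (1 : ℕ) 40, 1 / (j : ℝ) ^ 2 := by
      simp only [Finset.sum_Icc_succ_top, Finset.Icc_self, Finset.sum_singleton, Nat.reduceAdd,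
        Nat.reduceLeDiff]
      norm_num [Finset.sum_Icc_succ_top]
    have h3 : 1 / (1.2 * Y) ≤ 1 / 60 := one_div_le_one_div_of_le (by norm_num) (by linarith)
    have h4 : 0 ≤ Y ^ 2 / 1.44 - 6 * Y / 1.728 := by norm_num; nlinarith
    have h5 := mul_le_mul_of_nonneg_left h2 h4
    have h6 : (n : ℝ) ≤ (Y ^ 2 / 1.44 - 6 * Y / 1.728) * 1.62 - 40 * (1 / 2 + 1 / 60) := by
      rw [← hYn]
      norm_num
      nlinarith
    simp only [Nat.card_Icc, nsmul_eq_mul]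
    push_cast
    linarith
  have hn1 : (0 : ℝ) < n := by linarith
  refine le_of_mul_le_mul_left ?_ hn1
  calc (n : ℝ) * E = E * n := mul_comm _ _
    _ ≤ _ := by gcongr
    _ ≤ _ := key

theorem exp_sqrt_le (n : ℕ) : Real.exp (2.4 * √n) ≤ 210 * Fintype.card n.Partition := by
  induction n using Nat.strong_induction_on with
  | _ n ih =>
    rcases le_or_gt 2500 n with hn | hn
    · exact exp_sqrt_le_of_forall_lt hn ih
    · set c := Nat.sqrt (100 * n) with hc
      have h1 : c ^ 2 / 100 ≤ n := by
        have := Nat.sqrt_le' (100 * n)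
        rw [← hc] at this
        omega
      have h2 : 100 * n < (c + 1) ^ 2 := Nat.lt_succ_sqrt' _
      have h3 : c ≤ 500 := by
        have := Nat.sqrt_le' (100 * n)
        rw [← hc] at this
        by_contra h
        nlinarith
      have h4 := (card_bounds_of_lt fun n hn => card_lt_two_pow hn).2 c h3
      have h5 := card_mono h1
      have h6 : Real.exp 0.24 ≤ 1.2713 := by
        have := Real.exp_bound' (x := 0.24) (by norm_num) (by norm_num) (n := 5) (by norm_num)
        norm_num [Finset.sum_range_succ, Nat.factorial] at this
        norm_num
        linarith
      have h7 : √(n : ℝ) ≤ (c + 1) / 10 := by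
        rw [Real.sqrt_le_left (by positivity)]
        have : (100 * n : ℝ) < (c + 1) ^ 2 := by exact_mod_cast h2
        linarith
      have h8 : (1.2713 : ℝ) ^ (c + 1) ≤ 210 * Fintype.card (c ^ 2 / 100).Partition := by
        rw [show (1.2713 : ℝ) = 12713 / 10000 by norm_num, div_pow,
          div_le_iff₀ (by positivity)]
        exact_mod_cast h4
      calc Real.exp (2.4 * √n) ≤ Real.exp (((c + 1 : ℕ) : ℝ) * 0.24) := by
            rw [Real.exp_le_exp]
            push_cast
            linarith
        _ = Real.exp 0.24 ^ (c + 1) := Real.exp_nat_mul _ _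
        _ ≤ 1.2713 ^ (c + 1) := by gcongr
        _ ≤ _ := h8
        _ ≤ _ := mul_le_mul_of_nonneg_left (Nat.cast_le.2 h5) (by norm_num)

end LowerBound

section Main

theorem sum_pow_card_toFinset_eighth_le (n : ℕ) {t : ℝ} (ht : 0 < t) :
    ∑ l : n.Partition, (1 / 8 : ℝ) ^ l.parts.toFinset.card ≤ Real.exp (t * n + 0.41 / t) := by
  have h := sum_pow_card_toFinset_le (v := 7 / 8) (by norm_num) (by norm_num) ht n 20
  rw [show (1 : ℝ) - 7 / 8 = 1 / 8 by norm_num] at h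
  refine h.trans ?_
  gcongr
  have h1 := Real.pi_lt_d4
  have h2 : Real.pi ^ 2 < 3.1416 ^ 2 := by gcongr
  norm_num [Finset.sum_range_succ]
  norm_num at h2
  linarith

theorem log_eight_lt : Real.log 8 < 2.08 := by
  rw [show (8 : ℝ) = 2 ^ 3 by norm_num, Real.log_pow]
  have := Real.log_two_lt_d9
  norm_num
  linarith

theorem log_le_mul_add_two {z : ℝ} (hz : 0 < z) : Real.log z ≤ 0.05 * z + 2 := by
  have h1 := Real.log_le_sub_one_of_pos (x := z * Real.exp (-3)) (by positivity)
  rw [Real.log_mul hz.ne' (Real.exp_pos _).ne', Real.log_exp] at h1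
  have h2 : Real.exp (-3) ≤ 0.05 := by
    have h3 : Real.exp (-3) * Real.exp 1 ^ 3 = 1 := by
      rw [← Real.exp_nat_mul, ← Real.exp_add]
      norm_num
    have h4 : (2.7182818283 : ℝ) ^ 3 ≤ Real.exp 1 ^ 3 := by
      gcongr
      exact Real.exp_one_gt_d9.le
    have h5 := Real.exp_pos (-3)
    have h6 : (20 : ℝ) ≤ Real.exp 1 ^ 3 := le_trans (by norm_num) h4
    norm_num only at h3 ⊢
    nlinarith
  nlinarith

theorem le_log_card {n : ℕ} (hn : 2500 ≤ n) : 2.29 * √n ≤ Real.log (Fintype.card n.Partition) := by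
  have hP : (0 : ℝ) < Fintype.card n.Partition := by exact_mod_cast card_pos n
  have h1 := Real.log_le_log (Real.exp_pos _) (exp_sqrt_le n)
  rw [Real.log_exp, Real.log_mul (by norm_num) hP.ne'] at h1
  have h2 : Real.log 210 ≤ 5.5 := by
    have h3 : Real.log (210 ^ 4) ≤ Real.log (2 ^ 31) :=
      Real.log_le_log (by norm_num) (by norm_num)
    rw [Real.log_pow, Real.log_pow] at h3
    have h4 := Real.log_two_lt_d9
    norm_num at h3 h4 ⊢
    linarith
  have h3 : (50 : ℝ) ≤ √n := Real.le_sqrt_of_sq_le (by norm_num; exact_mod_cast hn)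
  linarith

theorem card_withoutOnes_mul_log_le (n : ℕ) (hr : 0 < (withoutOnes (n + 1)).card) {t : ℝ}
    (ht : 0 < t) :
    (withoutOnes (n + 1)).card *
      (Real.log (withoutOnes (n + 1)).card - t * (n + 1) - 0.41 / t) ≤
    Real.log 8 * Fintype.card n.Partition := by
  set r : ℝ := ((withoutOnes (n + 1)).card : ℝ) with hrd
  have hr' : 0 < r := Nat.cast_pos.2 hr
  set θ := Real.log r - t * (n + 1) - 0.41 / t with hθ
  have hS : Real.exp θ * ∑ l ∈ withoutOnes (n + 1), (1 / 8 : ℝ) ^ l.parts.toFinset.card ≤ r := by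
    calc _ ≤ Real.exp θ * ∑ l : (n + 1).Partition, (1 / 8 : ℝ) ^ l.parts.toFinset.card := by
          gcongr
          exact Finset.subset_univ _
      _ ≤ Real.exp θ * Real.exp (t * (n + 1 : ℕ) + 0.41 / t) := by
          gcongr
          exact sum_pow_card_toFinset_eighth_le (n + 1) ht
      _ = Real.exp (Real.log r) := by
          rw [← Real.exp_add]
          congr 1
          push_cast
          ring
      _ = r := Real.exp_log hr'
  have hd : ∀ d : ℕ, 1 + θ - Real.exp θ * (1 / 8 : ℝ) ^ d ≤ Real.log 8 * d := fun d => by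
    have h1 := Real.add_one_le_exp (θ - Real.log 8 * d)
    have h2 : Real.exp (θ - Real.log 8 * d) = Real.exp θ * (1 / 8 : ℝ) ^ d := by
      rw [sub_eq_add_neg, Real.exp_add, Real.exp_neg, mul_comm (Real.log 8), Real.exp_nat_mul,
        Real.exp_log (by norm_num), one_div, inv_pow]
    linarith
  have h3 : r * (1 + θ) - r ≤
      Real.log 8 * ((∑ l ∈ withoutOnes (n + 1), l.parts.toFinset.card : ℕ) : ℝ) := by
    calc _ ≤ r * (1 + θ) -
          Real.exp θ * ∑ l ∈ withoutOnes (n + 1), (1 / 8 : ℝ) ^ l.parts.toFinset.card := by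
          linarith
      _ = ∑ l ∈ withoutOnes (n + 1),
          (1 + θ - Real.exp θ * (1 / 8 : ℝ) ^ l.parts.toFinset.card) := by
          rw [Finset.sum_sub_distrib, ← Finset.mul_sum, Finset.sum_const, nsmul_eq_mul]
      _ ≤ ∑ l ∈ withoutOnes (n + 1), Real.log 8 * (l.parts.toFinset.card : ℝ) :=
          Finset.sum_le_sum fun l _ => hd _
      _ = _ := by push_cast; rw [Finset.mul_sum]
  calc r * θ = r * (1 + θ) - r := by ring
    _ ≤ _ := h3
    _ ≤ _ := by
      gcongr
      exact sum_card_toFinset_withoutOnes_le n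

theorem card_withoutOnes_mul_le {n : ℕ} (hn : 2500 ≤ n) :
    ((withoutOnes (n + 1)).card : ℝ) * n ≤
      Fintype.card n.Partition * Real.log (Fintype.card n.Partition) := by
  have hP : (0 : ℝ) < Fintype.card n.Partition := by exact_mod_cast card_pos n
  have hl := le_log_card hn
  set P : ℝ := (Fintype.card n.Partition : ℝ)
  set y := √(n : ℝ) with hy
  set r : ℝ := ((withoutOnes (n + 1)).card : ℝ) with hrd
  have hn0 : (2500 : ℝ) ≤ n := by exact_mod_cast hn
  have hyn : y ^ 2 = n := Real.sq_sqrt (by linarith)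
  have hy50 : 50 ≤ y := Real.le_sqrt_of_sq_le (by linarith)
  have hy0 : 0 < y := by linarith
  set ℓ := Real.log P with hℓ
  have hℓ0 : 0 < ℓ := by nlinarith
  by_contra! h
  have hr0 : 0 < r := pos_of_mul_pos_left ((mul_pos hP hℓ0).trans h) (by linarith)
  have h1 := card_withoutOnes_mul_log_le n (Nat.cast_pos.1 hr0) (t := 0.64 / y) (by positivity)
  rw [← hrd] at h1
  have h2 : ℓ - Real.log (n / ℓ) ≤ Real.log r := by
    rw [hℓ, ← Real.log_div hP.ne' (by positivity), ← hℓ]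
    refine Real.log_le_log (by positivity) ?_
    rw [div_div_eq_mul_div, div_le_iff₀ (by linarith)]
    exact h.le
  have h3 : n / ℓ ≤ y / 2.29 := by
    rw [div_le_div_iff₀ hℓ0 (by norm_num), ← hyn]
    nlinarith
  have h4 := log_le_mul_add_two (z := n / ℓ) (by positivity)
  have h5 : 0.64 / y * (n + 1) ≤ 0.64 * y + 0.0128 := by
    rw [← hyn, div_mul_eq_mul_div, div_le_iff₀ hy0]
    nlinarith
  have h6 : 0.41 / (0.64 / y) ≤ 0.641 * y := by
    rw [div_div_eq_mul_div, div_le_iff₀ (by norm_num)]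
    linarith
  have h7 : 0.94 * y ≤ Real.log r - 0.64 / y * (n + 1) - 0.41 / (0.64 / y) := by
    norm_num at h3 h4 h5 h6 hl ⊢
    linarith
  have h8 : P * 2.29 < r * y := by
    refine lt_of_mul_lt_mul_right ?_ hy0.le
    nlinarith
  have h9 : r * (0.94 * y) ≤ Real.log 8 * P :=
    (mul_le_mul_of_nonneg_left h7 hr0.le).trans h1
  have h10 := mul_lt_mul_of_pos_right log_eight_lt hP
  norm_num at h8 h9 h10
  linarith

theorem card_succ_pow_lt_of_le {n : ℕ} (hn : 2500 ≤ n) :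
    Fintype.card (n + 1).Partition ^ n < Fintype.card n.Partition ^ (n + 1) := by
  have hP : (0 : ℝ) < Fintype.card n.Partition := by exact_mod_cast card_pos n
  have hn0 : (2500 : ℝ) ≤ n := by exact_mod_cast hn
  have h1 := card_withoutOnes_mul_le hn
  have hl := le_log_card hn
  have hℓ0 : 0 < Real.log (Fintype.card n.Partition) := by
    have : 0 < √(n : ℝ) := Real.sqrt_pos.2 (by linarith)
    linarith
  have h : ((Fintype.card (n + 1).Partition : ℕ) : ℝ) ^ n <
      (Fintype.card n.Partition : ℝ) ^ (n + 1) := by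
    rw [card_succ, Nat.cast_add]
    set P : ℝ := (Fintype.card n.Partition : ℝ)
    set r : ℝ := ((withoutOnes (n + 1)).card : ℝ)
    have hr : r ≤ P * (Real.log P / n) := by
      rw [← mul_div_assoc, le_div_iff₀ (by linarith)]
      exact h1
    have h2 : P + r < P * Real.exp (Real.log P / n) := by
      have := Real.add_one_lt_exp (x := Real.log P / n) (by positivity)
      nlinarith
    calc (P + r) ^ n < (P * Real.exp (Real.log P / n)) ^ n := by
          gcongr
      _ = P ^ (n + 1) := by
          rw [mul_pow, ← Real.exp_nat_mul, mul_div_cancel₀ _ (by linarith), Real.exp_log hP,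
            pow_succ]
  exact_mod_cast h

theorem card_succ_pow_lt {n : ℕ} (hn : 6 ≤ n) :
    Fintype.card (n + 1).Partition ^ n < Fintype.card n.Partition ^ (n + 1) := by
  rcases lt_or_ge n 2500 with h | h
  · exact (card_bounds_of_lt fun n hn => card_lt_two_pow hn).1 n hn h
  · exact card_succ_pow_lt_of_le h

end Main

end Nat.Partition

/-- Sun's conjecture (Wang–Zhu, Chen–Zheng): the sequence `p(n)^(1/n)` of `n`-th
roots of the partition numbers is strictly decreasing for `n ≥ 6`; equivalently
`p(n)^(n+1) > p(n+1)^n` for all `n ≥ 6`. -/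
theorem sun_conjecture_partitions
    (p : ℕ → ℕ) (hp : ∀ n, p n = Fintype.card (Nat.Partition n)) :
    (∀ n, 6 ≤ n → (p n : ℝ) ^ ((n : ℝ)⁻¹) > (p (n + 1) : ℝ) ^ (((n : ℝ) + 1)⁻¹)) ∧
    (∀ n, 6 ≤ n → p n ^ (n + 1) > p (n + 1) ^ n) := by
  have key : ∀ n, 6 ≤ n → p (n + 1) ^ n < p n ^ (n + 1) := fun n hn => by
    rw [hp, hp]
    exact Nat.Partition.card_succ_pow_lt hn
  refine ⟨fun n hn => ?_, key⟩
  have hn0 : (0 : ℝ) < n := Nat.cast_pos.2 (by omega)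
  have h1 : (p (n + 1) : ℝ) ^ (n : ℝ) < (p n : ℝ) ^ ((n : ℝ) + 1) := by
    rw [show ((n : ℝ) + 1) = ((n + 1 : ℕ) : ℝ) by push_cast; rfl, Real.rpow_natCast,
      Real.rpow_natCast]
    exact_mod_cast key n hn
  have h2 := Real.rpow_lt_rpow (by positivity) h1 (z := (n : ℝ)⁻¹ * ((n : ℝ) + 1)⁻¹)
    (by positivity)
  rw [← Real.rpow_mul (by positivity), ← Real.rpow_mul (by positivity)] at h2
  rwa [mul_inv_cancel_left₀ hn0.ne', mul_comm (n : ℝ)⁻¹,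
    mul_inv_cancel_left₀ (by positivity)] at h2
end

section
/- The sequence {pp(n)^(1/n)}_{n≥6} is strictly decreasing, where pp(n) is the number of plane partitions of n. Equivalently, pp(n)^(n+1) > pp(n+1)^n for all n ≥ 6. -/
open Finset

/-- The sum of the squares of the divisors of `j`. -/
def sigmaTwo (j : ℕ) : ℕ := ∑ d ∈ j.divisors, d ^ 2

theorem sum_Icc_sum_divisorsAntidiagonal {M : Type*} [AddCommMonoid M] (G : ℕ → ℕ → M) (N : ℕ) :
    ∑ j ∈ Icc 1 N, ∑ x ∈ j.divisorsAntidiagonal, G x.1 x.2 =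
      ∑ m ∈ Icc 1 N, ∑ d ∈ Icc 1 (N / m), G m d := by
  rw [Finset.sum_sigma', Finset.sum_sigma']
  refine Finset.sum_bij' (fun x _ => ⟨x.2.1, x.2.2⟩) (fun y _ => ⟨y.1 * y.2, (y.1, y.2)⟩)
    ?_ ?_ ?_ ?_ ?_
  · rintro ⟨j, a, c⟩ h
    simp only [mem_sigma, mem_Icc, Nat.mem_divisorsAntidiagonal] at h ⊢
    obtain ⟨⟨h1, h2⟩, rfl, h3⟩ := h
    have ha : 0 < a := Nat.pos_of_ne_zero (by rintro rfl; simp at h3)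
    have hc : 0 < c := Nat.pos_of_ne_zero (by rintro rfl; simp at h3)
    exact ⟨⟨ha, by nlinarith⟩, hc, (Nat.le_div_iff_mul_le ha).2 (by nlinarith)⟩
  · rintro ⟨m, d⟩ h
    simp only [mem_sigma, mem_Icc, Nat.mem_divisorsAntidiagonal] at h ⊢
    obtain ⟨⟨h1, h2⟩, h3, h4⟩ := h
    have := (Nat.le_div_iff_mul_le h1).1 h4
    exact ⟨⟨by nlinarith, by nlinarith⟩, trivial, by positivity⟩
  · rintro ⟨j, a, c⟩ h
    simp only [mem_sigma, mem_Icc, Nat.mem_divisorsAntidiagonal] at h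
    obtain ⟨_, rfl, _⟩ := h
    rfl
  · rintro ⟨m, d⟩ _
    rfl
  · rintro ⟨j, a, c⟩ _
    rfl

theorem sum_sigmaTwo_mul (K : ℕ) (g : ℕ → ℝ) :
    ∑ j ∈ Icc 1 K, (sigmaTwo j : ℝ) * g j =
      ∑ m ∈ Icc 1 K, ∑ d ∈ Icc 1 (K / m), (d : ℝ) ^ 2 * g (m * d) := by
  rw [← sum_Icc_sum_divisorsAntidiagonal (fun m d => (d : ℝ) ^ 2 * g (m * d))]
  refine sum_congr rfl fun j _ => ?_
  rw [sigmaTwo, ← Nat.sum_divisorsAntidiagonal' (fun _ d => d ^ 2), Nat.cast_sum, sum_mul]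
  refine sum_congr rfl fun x hx => ?_
  rw [(Nat.mem_divisorsAntidiagonal.1 hx).1]
  push_cast
  ring

theorem sum_inv_sq_le (K : ℕ) (hK : 1 ≤ K) :
    ∑ m ∈ Icc 1 K, 1 / ((m : ℕ) : ℝ) ^ 2 ≤ 5 / 3 - 1 / ((K : ℝ) + 1 / 2) := by
  induction K, hK using Nat.le_induction with
  | base => norm_num
  | succ K hK ih =>
    rw [sum_Icc_succ_top (by omega)]
    have : 1 / ((K : ℝ) + 1) ^ 2 ≤ 1 / (K + 1 / 2) - 1 / (K + 1 + 1 / 2) := by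
      rw [div_sub_div _ _ (by positivity) (by positivity), div_le_div_iff₀ (by positivity)
        (by positivity)]
      ring_nf
      norm_num
    push_cast
    linarith

theorem sigmaTwo_le (j : ℕ) : (sigmaTwo j : ℝ) ≤ 2 * (j : ℝ) ^ 2 := by
  rcases Nat.eq_zero_or_pos j with rfl | hj
  · simp [sigmaTwo]
  have h1 : (sigmaTwo j : ℝ) ≤ ∑ m ∈ Icc 1 j, (j : ℝ) ^ 2 * (1 / ((m : ℕ) : ℝ) ^ 2) := by
    rw [sigmaTwo, ← Nat.sum_div_divisors j (fun d => d ^ 2), Nat.cast_sum]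
    refine (sum_le_sum (g := fun m : ℕ => (j : ℝ) ^ 2 * (1 / (m : ℝ) ^ 2)) fun d hd => ?_).trans
      (sum_le_sum_of_subset_of_nonneg (fun d hd => ?_) fun _ _ _ => by positivity)
    · rw [Nat.cast_pow, Nat.cast_div (Nat.dvd_of_mem_divisors hd), div_pow]
      · exact le_of_eq (by ring)
      · exact_mod_cast (Nat.pos_of_mem_divisors hd).ne'
    · exact mem_Icc.2 ⟨Nat.pos_of_mem_divisors hd, Nat.divisor_le hd⟩
  rw [← mul_sum] at h1
  have h2 := sum_inv_sq_le j hj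
  have h3 : (0 : ℝ) ≤ 1 / (j + 1 / 2) := by positivity
  nlinarith [sq_nonneg (j : ℝ)]

theorem le_sigmaTwo (j : ℕ) (hj : 2 ≤ j) : (j : ℝ) ^ 2 + 1 ≤ sigmaTwo j := by
  have h : ∑ d ∈ {1, j}, d ^ 2 ≤ sigmaTwo j :=
    sum_le_sum_of_subset fun d hd => by
      rcases mem_insert.1 hd with rfl | hd
      · simp; omega
      · rw [mem_singleton.1 hd]; simp; omega
  rw [sum_pair (by omega)] at h
  have : ((1 ^ 2 + j ^ 2 : ℕ) : ℝ) ≤ sigmaTwo j := by exact_mod_cast h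
  push_cast at this
  linarith

theorem secondDiff_nonneg (b : ℕ → ℝ) (hb0 : b 0 = 1)
    (hb : ∀ n : ℕ, (n : ℝ) * b n =
      ∑ k ∈ range n, ((sigmaTwo (n - k) : ℝ) - 2) * b k) :
    b 1 = -1 ∧ ∀ n, 2 ≤ n → 0 ≤ b n := by
  have s1 : sigmaTwo 1 = 1 := by decide
  have s2 : sigmaTwo 2 = 5 := by decide
  have s3 : sigmaTwo 3 = 10 := by decide
  have s4 : sigmaTwo 4 = 21 := by decide
  have s5 : sigmaTwo 5 = 26 := by decide
  have s6 : sigmaTwo 6 = 50 := by decide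
  have s7 : sigmaTwo 7 = 50 := by decide
  have b1 : b 1 = -1 := by
    have := hb 1
    norm_num [sum_range_succ, s1, hb0] at this
    linarith
  have b2 : b 2 = 2 := by
    have := hb 2
    norm_num [sum_range_succ, s1, s2, hb0, b1] at this
    linarith
  have b3 : b 3 = 1 := by
    have := hb 3
    norm_num [sum_range_succ, s1, s2, s3, hb0, b1, b2] at this
    linarith
  have b4 : b 4 = 4 := by
    have := hb 4
    norm_num [sum_range_succ, s1, s2, s3, s4, hb0, b1, b2, b3] at this
    linarith
  have b5 : b 5 = 4 := by
    have := hb 5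
    norm_num [sum_range_succ, s1, s2, s3, s4, s5, hb0, b1, b2, b3, b4] at this
    linarith
  have b6 : b 6 = 13 := by
    have := hb 6
    norm_num [sum_range_succ, s1, s2, s3, s4, s5, s6, hb0, b1, b2, b3, b4, b5] at this
    linarith
  have b7 : b 7 = 14 := by
    have := hb 7
    norm_num [sum_range_succ, s1, s2, s3, s4, s5, s6, s7, hb0, b1, b2, b3, b4, b5, b6] at this
    linarith
  refine ⟨b1, fun n => ?_⟩
  induction n using Nat.strong_induction_on with
  | _ n ih =>
  intro hn
  rcases lt_or_ge n 8 with h8 | h8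
  · interval_cases n <;> simp_all
  obtain ⟨M, rfl⟩ : ∃ M, n = M + 3 + 1 := ⟨n - 4, by omega⟩
  have hM : (4 : ℝ) ≤ M := by exact_mod_cast (by omega : 4 ≤ M)
  have e1 := hb (M + 3 + 1)
  have e2 := hb (M + 3)
  rw [sum_range_succ] at e1
  simp only [Nat.add_sub_cancel_left, s1] at e1
  have key : 0 ≤ ∑ k ∈ range (M + 3), (((M + 3 : ℕ) : ℝ) *
      ((sigmaTwo (M + 3 + 1 - k) : ℝ) - 2) - ((sigmaTwo (M + 3 - k) : ℝ) - 2)) * b k := by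
    rw [sum_range_succ', sum_range_succ', sum_range_succ']
    have hrest : 0 ≤ ∑ k ∈ range M, (((M + 3 : ℕ) : ℝ) *
      ((sigmaTwo (M + 3 + 1 - (k + 1 + 1 + 1)) : ℝ) - 2) -
        ((sigmaTwo (M + 3 - (k + 1 + 1 + 1)) : ℝ) - 2)) * b (k + 1 + 1 + 1) := by
      refine sum_nonneg fun k hk => mul_nonneg ?_ (ih _ ?_ (by omega))
      · have hk := mem_range.1 hk
        obtain ⟨i, hi⟩ : ∃ i, M = k + i := ⟨M - k, by omega⟩
        have h1 := le_sigmaTwo (i + 1) (by omega)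
        have h2 := sigmaTwo_le i
        have hi1 : (1 : ℝ) ≤ i := by exact_mod_cast (by omega : 1 ≤ i)
        have hiM : (i : ℝ) ≤ M := by exact_mod_cast (by omega : i ≤ M)
        rw [show M + 3 + 1 - (k + 1 + 1 + 1) = i + 1 by omega,
          show M + 3 - (k + 1 + 1 + 1) = i by omega]
        push_cast at h1 ⊢
        have : ((M : ℝ) + 3) * ((i + 1) ^ 2 - 1) ≤ (M + 3) * ((sigmaTwo (i + 1) : ℝ) - 2) :=
          mul_le_mul_of_nonneg_left (by linarith) (by linarith)
        nlinarith [mul_nonneg (by linarith : (0 : ℝ) ≤ (M : ℝ) + 3 - 2) (sq_nonneg (i : ℝ))]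
      · have hk := mem_range.1 hk
        omega
    generalize (∑ k ∈ range M, _ : ℝ) = R at hrest ⊢
    have l1 := le_sigmaTwo (M + 4) (by omega)
    have l2 := le_sigmaTwo (M + 2) (by omega)
    have l4 := sigmaTwo_le (M + 3)
    have l5 := sigmaTwo_le (M + 1)
    rw [show 0 + 1 + 1 = 2 from rfl, show 0 + 1 = 1 from rfl, hb0, b1, b2,
      show M + 3 + 1 - 2 = M + 2 by omega, show M + 3 - 2 = M + 1 by omega,
      show M + 3 + 1 - 1 = M + 3 by omega, show M + 3 - 1 = M + 2 by omega,
      show M + 3 + 1 - 0 = M + 4 by omega, show M + 3 - 0 = M + 3 by omega]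
    push_cast at l1 l2 l4 l5 ⊢
    have : ((M : ℝ) + 3) * (2 * ((M + 2) ^ 2 - 1) + ((M + 4) ^ 2 - 1) - (2 * (M + 3) ^ 2 - 2)) ≤
        (M + 3) * (2 * ((sigmaTwo (M + 2) : ℝ) - 2) + ((sigmaTwo (M + 4) : ℝ) - 2) -
          ((sigmaTwo (M + 3) : ℝ) - 2)) :=
      mul_le_mul_of_nonneg_left (by linarith) (by linarith)
    nlinarith
  simp only [sub_mul (((M + 3 : ℕ) : ℝ) * _) _ (b _), sum_sub_distrib,
    mul_assoc, ← mul_sum] at key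
  have hpos : (0 : ℝ) < ((M + 3 : ℕ) : ℝ) * ((M + 3 + 1 : ℕ) : ℝ) := by positivity
  refine nonneg_of_mul_nonneg_right (a := ((M + 3 : ℕ) : ℝ) * ((M + 3 + 1 : ℕ) : ℝ)) ?_ hpos
  rw [mul_assoc, e1]
  rw [← e2] at key
  push_cast at key ⊢
  linarith

/-- The double partial sums of `sigmaTwo`. -/
def sigmaTwoSums (k : ℕ) : ℝ := ∑ j ∈ Icc 1 k, (sigmaTwo j : ℝ) * ((k : ℝ) + 1 - j)

theorem sigmaTwoSums_succ (k : ℕ) :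
    sigmaTwoSums (k + 1) = sigmaTwoSums k + ∑ j ∈ Icc 1 (k + 1), (sigmaTwo j : ℝ) := by
  have h : sigmaTwoSums k = ∑ j ∈ Icc 1 (k + 1), (sigmaTwo j : ℝ) * ((k : ℝ) + 1 - j) := by
    rw [sum_Icc_succ_top (by omega)]
    push_cast
    rw [sub_self, mul_zero, add_zero, sigmaTwoSums]
  rw [h, ← sum_add_distrib, sigmaTwoSums]
  refine sum_congr rfl fun j _ => ?_
  push_cast
  ring

theorem sum_antidiagonal_sigmaTwo (n : ℕ) (f : ℕ → ℝ) :
    ∑ x ∈ antidiagonal n, (sigmaTwo x.1 : ℝ) * f x.2 =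
      ∑ j ∈ Icc 1 n, (sigmaTwo j : ℝ) * f (n - j) := by
  rw [Nat.sum_antidiagonal_eq_sum_range_succ (fun i j => (sigmaTwo i : ℝ) * f j),
    Finset.range_eq_Ico, sum_eq_sum_Ico_succ_bot (by omega)]
  simp only [sigmaTwo, Nat.divisors_zero, sum_empty, Nat.cast_zero, zero_mul, zero_add]
  rfl

open PowerSeries in
theorem exists_secondDiff (p : ℕ → ℝ) (hp0 : p 0 = 1)
    (hrec : ∀ n : ℕ, 1 ≤ n →
      (n : ℝ) * p n = ∑ j ∈ Icc 1 n, (sigmaTwo j : ℝ) * p (n - j)) :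
    ∃ b : ℕ → ℝ, b 0 = 1 ∧ b 1 = -1 ∧ (∀ n, 2 ≤ n → 0 ≤ b n) ∧
      (∀ n : ℕ, p n = ∑ k ∈ range (n + 1), (((n - k : ℕ) : ℝ) + 1) * b k) ∧
      ∀ n : ℕ, (n : ℝ) * p n = ∑ k ∈ range (n + 1), sigmaTwoSums (n - k) * b k := by
  set P : ℝ⟦X⟧ := PowerSeries.mk p with hP
  set G : ℝ⟦X⟧ := PowerSeries.mk fun j => (sigmaTwo j : ℝ) with hG
  set I : ℝ⟦X⟧ := PowerSeries.mk 1 with hI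
  have hI1 : I * (1 - X) = 1 := PowerSeries.mk_one_mul_one_sub_eq_one ℝ
  have hI2 : I ^ 2 = PowerSeries.mk fun n => (n : ℝ) + 1 := by
    rw [hI, PowerSeries.mk_one_pow_eq_mk_choose_add ℝ 1]
    ext n
    simp [add_comm]
  set B : ℝ⟦X⟧ := (1 - X) ^ 2 * P with hB
  have hPB : P = I ^ 2 * B := by
    rw [hB]
    linear_combination (-(I * (1 - X)) - 1) * P * hI1
  have hGP : ∀ n : ℕ, (n : ℝ) * p n = coeff n (G * P) := by
    intro n
    rw [PowerSeries.coeff_mul]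
    simp only [hG, hP, coeff_mk]
    rw [sum_antidiagonal_sigmaTwo]
    rcases Nat.eq_zero_or_pos n with rfl | hn
    · simp
    · exact hrec n hn
  have hder : X * d⁄dX ℝ P = G * P := by
    ext n
    rw [← hGP]
    cases n with
    | zero => simp
    | succ n =>
      rw [PowerSeries.coeff_succ_X_mul, PowerSeries.coeff_derivative, hP, coeff_mk]
      push_cast
      ring
  have hderB : X * d⁄dX ℝ B = (G - 2 * (X * I)) * B := by
    have : d⁄dX ℝ B = (1 - X) ^ 2 * d⁄dX ℝ P - 2 * (1 - X) * P := by
      rw [hB]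
      simp [Derivation.leibniz, Derivation.leibniz_pow]
      ring
    rw [this, hB]
    linear_combination (1 - X) ^ 2 * hder + 2 * X * (1 - X) * P * hI1
  have hGI : ∀ n, coeff n (G * I ^ 2) = sigmaTwoSums n := by
    intro n
    rw [PowerSeries.coeff_mul, hI2]
    simp only [hG, coeff_mk]
    rw [sum_antidiagonal_sigmaTwo n fun c => (c : ℝ) + 1, sigmaTwoSums]
    refine sum_congr rfl fun j hj => ?_
    rw [Nat.cast_sub (mem_Icc.1 hj).2]
    ring
  have hXI : ∀ n, coeff n (X * I) = if n = 0 then (0 : ℝ) else 1 := by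
    intro n
    cases n with
    | zero => simp
    | succ n => simp [PowerSeries.coeff_succ_X_mul, hI]
  have hconv : ∀ (F H : ℝ⟦X⟧) (n : ℕ),
      coeff n (F * H) = ∑ k ∈ range (n + 1), coeff (n - k) F * coeff k H := by
    intro F H n
    rw [mul_comm, PowerSeries.coeff_mul,
      Nat.sum_antidiagonal_eq_sum_range_succ (fun i j => coeff i H * coeff j F)]
    exact sum_congr rfl fun k _ => mul_comm _ _
  have hb0 : coeff 0 B = 1 := by
    simp [hB, hP, hp0]
  have hbrec : ∀ n : ℕ, (n : ℝ) * coeff n B =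
      ∑ k ∈ range n, ((sigmaTwo (n - k) : ℝ) - 2) * coeff k B := by
    intro n
    have h1 : (n : ℝ) * coeff n B = coeff n (X * d⁄dX ℝ B) := by
      cases n with
      | zero => simp
      | succ n =>
        rw [PowerSeries.coeff_succ_X_mul, PowerSeries.coeff_derivative]
        push_cast
        ring
    rw [h1, hderB, hconv, sum_range_succ]
    have h2 : ∀ m, coeff m (G - 2 * (X * I)) = (sigmaTwo m : ℝ) - if m = 0 then 0 else 2 := by
      intro m
      rw [map_sub, two_mul, map_add, hXI, hG, coeff_mk]
      split_ifs <;> norm_num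
    simp only [h2]
    rw [Nat.sub_self]
    simp only [sigmaTwo, Nat.divisors_zero, sum_empty, Nat.cast_zero, if_true, sub_zero, zero_mul,
      add_zero]
    refine sum_congr rfl fun k hk => ?_
    rw [if_neg (by have := mem_range.1 hk; omega)]
  obtain ⟨hb1, hb2⟩ := secondDiff_nonneg (fun n => coeff n B) hb0 hbrec
  refine ⟨fun n => coeff n B, hb0, hb1, hb2, fun n => ?_, fun n => ?_⟩
  · have : p n = coeff n P := by rw [hP, coeff_mk]
    rw [this, hPB, hconv, hI2]
    simp only [coeff_mk]
  · rw [hGP, hPB, ← mul_assoc, hconv]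
    simp only [hGI]

theorem succ_mul_le_of_sigmaTwoSums (p : ℕ → ℝ) (hp0 : p 0 = 1)
    (hrec : ∀ n : ℕ, 1 ≤ n →
      (n : ℝ) * p n = ∑ j ∈ Icc 1 n, (sigmaTwo j : ℝ) * p (n - j))
    (Ψ : ℕ → ℝ) (α β : ℝ)
    (hΨ : ∀ k, Ψ k = (1 + α) * sigmaTwoSums k + β * (k + 1) - sigmaTwoSums (k + 1))
    (n : ℕ) (hn : 2 ≤ n) (hpos : ∀ k, 0 ≤ Ψ k) (hmono : Ψ (n - 1) ≤ Ψ n) :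
    ((n : ℝ) + 1) * p (n + 1) ≤ ((1 + α) * n + β) * p n := by
  obtain ⟨b, hb0, hb1, hb, hp, hnp⟩ := exists_secondDiff p hp0 hrec
  have h1 := hnp (n + 1)
  rw [sum_range_succ, Nat.sub_self] at h1
  have h0 : sigmaTwoSums 0 = 0 := by simp [sigmaTwoSums]
  rw [h0, zero_mul, add_zero] at h1
  push_cast at h1
  have h2 : ((1 + α) * n + β) * p n - ((n : ℝ) + 1) * p (n + 1) =
      ∑ k ∈ range (n + 1), Ψ (n - k) * b k := by
    rw [h1, show ((1 + α) * n + β) * p n = (1 + α) * (n * p n) + β * p n by ring, hnp n, hp n,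
      mul_sum, mul_sum, ← sum_add_distrib, ← sum_sub_distrib]
    refine sum_congr rfl fun k hk => ?_
    rw [hΨ, show n + 1 - k = n - k + 1 by have := mem_range.1 hk; omega]
    ring
  have h3 : 0 ≤ ∑ k ∈ range (n + 1), Ψ (n - k) * b k := by
    obtain ⟨m, rfl⟩ : ∃ m, n = m + 1 := ⟨n - 1, by omega⟩
    rw [sum_range_succ', sum_range_succ']
    have : 0 ≤ ∑ k ∈ range m, Ψ (m + 1 - (k + 1 + 1)) * b (k + 1 + 1) :=
      sum_nonneg fun k _ => mul_nonneg (hpos _) (hb _ (by omega))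
    rw [hb0, show 0 + 1 = 1 from rfl, hb1]
    simp only [Nat.sub_zero, mul_one]
    linarith
  linarith

theorem sum_Icc_sq (D : ℕ) :
    ∑ d ∈ Icc 1 D, (d : ℝ) ^ 2 = (D : ℝ) * (D + 1) * (2 * D + 1) / 6 := by
  induction D with
  | zero => simp
  | succ D ih =>
    rw [sum_Icc_succ_top (by omega), ih]
    push_cast
    ring

theorem sum_Icc_cube (D : ℕ) :
    ∑ d ∈ Icc 1 D, (d : ℝ) ^ 3 = ((D : ℝ) * (D + 1) / 2) ^ 2 := by
  induction D with
  | zero => simp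
  | succ D ih =>
    rw [sum_Icc_succ_top (by omega), ih]
    push_cast
    ring

theorem sum_inv_cube_le (K : ℕ) : ∑ m ∈ Icc 1 K, 1 / ((m : ℕ) : ℝ) ^ 3 ≤ 65 / 54 := by
  rcases lt_or_ge K 3 with h | h
  · interval_cases K <;> norm_num [sum_Icc_succ_top]
  suffices ∑ m ∈ Icc 1 K, 1 / ((m : ℕ) : ℝ) ^ 3 ≤ 65 / 54 - 1 / (2 * (K : ℝ) * (K + 1)) by
    have h2 : (0 : ℝ) ≤ 1 / (2 * (K : ℝ) * (K + 1)) := by positivity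
    linarith
  induction K, h using Nat.le_induction with
  | base => norm_num [sum_Icc_succ_top]
  | succ K hK ih =>
    rw [sum_Icc_succ_top (by omega)]
    have hK0 : (0 : ℝ) < K := by exact_mod_cast (by omega : 0 < K)
    have : 1 / ((K : ℝ) + 1) ^ 3 ≤
        1 / (2 * (K : ℝ) * (K + 1)) - 1 / (2 * ((K : ℝ) + 1) * (K + 1 + 1)) := by
      rw [div_sub_div _ _ (by positivity) (by positivity), div_le_div_iff₀ (by positivity)
        (by positivity)]
      have : (0 : ℝ) ≤ 4 * (K + 1) ^ 2 := by positivity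
      nlinarith
    push_cast
    linarith

theorem one_le_sum_inv_cube (K : ℕ) (hK : 1 ≤ K) :
    1 ≤ ∑ m ∈ Icc 1 K, 1 / ((m : ℕ) : ℝ) ^ 3 := by
  have := single_le_sum (f := fun m : ℕ => 1 / (m : ℝ) ^ 3) (s := Icc 1 K)
    (fun _ _ => by positivity) (mem_Icc.2 ⟨le_refl 1, hK⟩)
  simpa using this

theorem sum_inv_le (K : ℕ) : ∑ m ∈ Icc 1 K, 1 / ((m : ℕ) : ℝ) ≤ K / 10 + 2 := by
  rcases lt_or_ge K 10 with h | h
  · interval_cases K <;> norm_num [sum_Icc_succ_top]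
  induction K, h using Nat.le_induction with
  | base => norm_num [sum_Icc_succ_top]
  | succ K hK ih =>
    rw [sum_Icc_succ_top (by omega)]
    have hK0 : (10 : ℝ) ≤ K := by exact_mod_cast hK
    have : 1 / ((K : ℝ) + 1) ≤ 1 / 10 :=
      one_div_le_one_div_of_le (by norm_num) (by linarith)
    push_cast
    linarith

theorem sum_sigmaTwo_le (K : ℕ) :
    ∑ j ∈ Icc 1 K, (sigmaTwo j : ℝ) ≤
      (∑ m ∈ Icc 1 K, 1 / ((m : ℕ) : ℝ) ^ 3) * K ^ 3 / 3 + 5 / 6 * K ^ 2 +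
        (∑ m ∈ Icc 1 K, 1 / ((m : ℕ) : ℝ)) * K / 6 := by
  rcases Nat.eq_zero_or_pos K with rfl | hK
  · simp
  have h1 := sum_sigmaTwo_mul K fun _ => 1
  simp only [mul_one] at h1
  have h2 : ∀ m ∈ Icc 1 K, ∑ d ∈ Icc 1 (K / m), (d : ℝ) ^ 2 ≤
      1 / (m : ℝ) ^ 3 * (K ^ 3 / 3) + 1 / (m : ℝ) ^ 2 * (K ^ 2 / 2) + 1 / (m : ℝ) * (K / 6) := by
    intro m hm
    have hm0 : (0 : ℝ) < m := by exact_mod_cast (mem_Icc.1 hm).1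
    rw [sum_Icc_sq]
    have hD : ((K / m : ℕ) : ℝ) ≤ K / m := Nat.cast_div_le
    calc ((K / m : ℕ) : ℝ) * ((K / m : ℕ) + 1) * (2 * (K / m : ℕ) + 1) / 6
        ≤ ((K : ℝ) / m) * ((K : ℝ) / m + 1) * (2 * ((K : ℝ) / m) + 1) / 6 := by gcongr
      _ = _ := by field_simp; ring
  have h3 := sum_inv_sq_le K hK
  have h4 : (0 : ℝ) ≤ 1 / (K + 1 / 2) := by positivity
  rw [h1]
  refine (sum_le_sum h2).trans ?_
  rw [sum_add_distrib, sum_add_distrib, ← sum_mul, ← sum_mul, ← sum_mul]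
  have h5 : (∑ m ∈ Icc 1 K, 1 / ((m : ℕ) : ℝ) ^ 2) * ((K : ℝ) ^ 2 / 2) ≤
      5 / 3 * ((K : ℝ) ^ 2 / 2) :=
    mul_le_mul_of_nonneg_right (by linarith) (by positivity)
  linarith

theorem le_sigmaTwoSums (k : ℕ) :
    ((∑ m ∈ Icc 1 (k + 1), 1 / ((m : ℕ) : ℝ) ^ 3) * ((k : ℝ) + 1) ^ 4 -
        (∑ m ∈ Icc 1 (k + 1), 1 / ((m : ℕ) : ℝ)) * ((k : ℝ) + 1) ^ 2) / 12 ≤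
      sigmaTwoSums k := by
  have h0 : sigmaTwoSums k = ∑ j ∈ Icc 1 (k + 1), (sigmaTwo j : ℝ) * ((k : ℝ) + 1 - j) := by
    rw [sum_Icc_succ_top (by omega)]
    push_cast
    rw [sub_self, mul_zero, add_zero, sigmaTwoSums]
  rw [h0, sum_sigmaTwo_mul (k + 1) fun j => (k : ℝ) + 1 - j, sum_mul, sum_mul,
    ← sum_sub_distrib, sum_div]
  refine sum_le_sum fun m hm => ?_
  have hm1 := (mem_Icc.1 hm).1
  have hm0 : (0 : ℝ) < m := by exact_mod_cast hm1
  set D := (k + 1) / m with hDdef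
  obtain ⟨y, hy⟩ : ∃ y : ℝ, y = ((k : ℝ) + 1) / m := ⟨_, rfl⟩
  have hky : (k : ℝ) + 1 = m * y := by rw [hy]; field_simp
  have hD1 : (D : ℝ) ≤ y := by
    rw [hy, hDdef]
    exact_mod_cast (Nat.cast_div_le : (((k + 1) / m : ℕ) : ℝ) ≤ ((k + 1 : ℕ) : ℝ) / m)
  have hD2 : y ≤ D + 1 := by
    rw [hy, div_le_iff₀ hm0]
    have : k + 1 < m * (D + 1) := Nat.lt_mul_div_succ (k + 1) hm1
    have : ((k + 1 : ℕ) : ℝ) ≤ ((m * (D + 1) : ℕ) : ℝ) := by exact_mod_cast this.le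
    push_cast at this
    linarith
  have hsum : ∑ d ∈ Icc 1 D, (d : ℝ) ^ 2 * ((k : ℝ) + 1 - ((m * d : ℕ) : ℝ)) =
      m * (y * ((D : ℝ) * (D + 1) * (2 * D + 1) / 6) - ((D : ℝ) * (D + 1) / 2) ^ 2) := by
    rw [← sum_Icc_sq, ← sum_Icc_cube, mul_sum, ← sum_sub_distrib, mul_sum, hky]
    refine sum_congr rfl fun d _ => ?_
    push_cast
    ring
  rw [hsum, hky]
  have hl : (1 / (m : ℝ) ^ 3 * (m * y) ^ 4 - 1 / (m : ℝ) * (m * y) ^ 2) / 12 =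
      m * ((y ^ 4 - y ^ 2) / 12) := by
    field_simp
  rw [hl]
  refine mul_le_mul_of_nonneg_left ?_ hm0.le
  obtain ⟨θ, rfl⟩ : ∃ θ, y = D + θ := ⟨y - D, by ring⟩
  have hθ0 : 0 ≤ θ := by linarith
  have hθ1 : 0 ≤ 1 - θ := by linarith
  have : 0 ≤ θ * (1 - θ) * (θ ^ 2 + (4 * D + 1) * θ + (6 * D ^ 2 + 4 * D)) := by positivity
  linarith

theorem ratio_defect_nonneg (t : ℝ) (ht : 10 ≤ t) (k : ℕ) :
    0 ≤ (1 + 5 / (4 * t)) * sigmaTwoSums k +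
      (609 / 1000 * t ^ 2 + 19 / 10 * t + 2) * (k + 1) - sigmaTwoSums (k + 1) := by
  have hS := sum_sigmaTwo_le (k + 1)
  have hU := le_sigmaTwoSums k
  have hZ1 := one_le_sum_inv_cube (k + 1) (by omega)
  have hZ2 := sum_inv_cube_le (k + 1)
  have hH := sum_inv_le (k + 1)
  rw [sigmaTwoSums_succ]
  generalize ∑ j ∈ Icc 1 (k + 1), (sigmaTwo j : ℝ) = S at *
  generalize (∑ m ∈ Icc 1 (k + 1), 1 / ((m : ℕ) : ℝ) ^ 3) = Z at *
  generalize (∑ m ∈ Icc 1 (k + 1), 1 / ((m : ℕ) : ℝ)) = H at *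
  generalize sigmaTwoSums k = U at *
  push_cast at hS hH
  obtain ⟨K, hK⟩ : ∃ K : ℝ, K = (k : ℝ) + 1 := ⟨_, rfl⟩
  have hK0 : 0 < K := by rw [hK]; positivity
  rw [← hK] at hS hU hH ⊢
  have ht0 : 0 < t := by linarith
  obtain ⟨x, hx⟩ : ∃ x : ℝ, K = 32 / 15 * t + x := ⟨K - 32 / 15 * t, by ring⟩
  -- the cubic `K ^ 2 / 3 - α K ^ 3 / 12` lies below its maximum
  have hf : K ^ 2 / 3 - 5 / (4 * t) * K ^ 3 / 12 - 1024 / 2025 * t ^ 2 =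
      -(5 / (48 * t) * x ^ 2 * (K + 16 / 15 * t)) := by
    rw [hx]; field_simp; ring
  have hf0 : 0 ≤ 5 / (48 * t) * x ^ 2 * (K + 16 / 15 * t) := by positivity
  have hH' : H * (1 / 6 + 5 / (4 * t) / 12 * K) ≤
      (K / 10 + 2) * (1 / 6 + 5 / (4 * t) / 12 * K) :=
    mul_le_mul_of_nonneg_right hH (by positivity)
  have hK2 : K ^ 2 / t = 1024 / 225 * t + 64 / 15 * x + x ^ 2 / t := by
    rw [hx]; field_simp; ring
  have hK1 : K / t = 32 / 15 + x / t := by rw [hx]; field_simp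
  have hx2 : x ^ 2 / t ≤ x ^ 2 / 10 := div_le_div_of_nonneg_left (sq_nonneg x) (by norm_num) ht
  have main : 17 / 20 * K + 1 / 3 + K ^ 2 / t / 96 + 5 * (K / t) / 24 ≤
      5 / (48 * t) * x ^ 2 * (K + 16 / 15 * t) + 19 / 10 * t + 2 := by
    rcases le_or_gt x 0 with hx0 | hx0
    · have e1 : K ^ 2 / t ≤ 1024 / 225 * t := by
        rw [div_le_iff₀ ht0]; nlinarith
      have e2 : K / t ≤ 32 / 15 := by
        rw [div_le_iff₀ ht0]; nlinarith
      nlinarith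
    · have e1 : x ^ 2 / 3 ≤ 5 / (48 * t) * x ^ 2 * (K + 16 / 15 * t) := by
        have : x ^ 2 / 3 = 5 / (48 * t) * x ^ 2 * (16 / 5 * t) := by field_simp; norm_num
        rw [this]
        refine mul_le_mul_of_nonneg_left (by linarith) (by positivity)
      have e2 : x / t ≤ x / 10 := div_le_div_of_nonneg_left hx0.le (by norm_num) ht
      rw [hK2, hK1]
      nlinarith [sq_nonneg (x - 11 / 8)]
  have hZf : Z * (K ^ 2 / 3 - 5 / (4 * t) * K ^ 3 / 12) ≤
      65 / 54 * (1024 / 2025 * t ^ 2) - 5 / (48 * t) * x ^ 2 * (K + 16 / 15 * t) := by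
    have : K ^ 2 / 3 - 5 / (4 * t) * K ^ 3 / 12 =
      1024 / 2025 * t ^ 2 - 5 / (48 * t) * x ^ 2 * (K + 16 / 15 * t) := by linarith
    rw [this]
    nlinarith [mul_nonneg (by linarith : 0 ≤ Z - 1) hf0,
      mul_nonneg (by linarith : 0 ≤ 65 / 54 - Z) (by positivity : 0 ≤ 1024 / 2025 * t ^ 2)]
  have hU' : 5 / (4 * t) * ((Z * K ^ 4 - H * K ^ 2) / 12) ≤ 5 / (4 * t) * U :=
    mul_le_mul_of_nonneg_left hU (by positivity)
  have hfin : Z * (K ^ 2 / 3 - 5 / (4 * t) * K ^ 3 / 12) + 5 / 6 * K +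
      H * (1 / 6 + 5 / (4 * t) / 12 * K) ≤ 609 / 1000 * t ^ 2 + 19 / 10 * t + 2 := by
    have e : (K / 10 + 2) * (1 / 6 + 5 / (4 * t) / 12 * K) =
        K / 60 + 1 / 3 + K ^ 2 / t / 96 + 5 * (K / t) / 24 := by
      field_simp; ring
    rw [e] at hH'
    nlinarith [sq_nonneg t]
  have hfinK := mul_le_mul_of_nonneg_left hfin hK0.le
  have e : K * (Z * (K ^ 2 / 3 - 5 / (4 * t) * K ^ 3 / 12) + 5 / 6 * K +
      H * (1 / 6 + 5 / (4 * t) / 12 * K)) = Z * K ^ 3 / 3 + 5 / 6 * K ^ 2 + H * K / 6 -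
        5 / (4 * t) * ((Z * K ^ 4 - H * K ^ 2) / 12) := by ring
  rw [add_mul, one_mul, mul_comm _ K]
  linarith

theorem ratio_defect_mono (t : ℝ) (ht : 10 ≤ t) (k : ℕ) (hk : t ^ 3 = (k : ℝ) + 1) (β : ℝ)
    (hβ : 0 ≤ β) :
    (1 + 5 / (4 * t)) * sigmaTwoSums k + β * (k + 1) - sigmaTwoSums (k + 1) ≤
      (1 + 5 / (4 * t)) * sigmaTwoSums (k + 1) + β * ((k + 1 : ℕ) + 1) -
        sigmaTwoSums (k + 1 + 1) := by
  have hS : ((k + 1 : ℕ) : ℝ) * ((k + 1 : ℕ) + 1) * (2 * (k + 1 : ℕ) + 1) / 6 ≤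
      ∑ j ∈ Icc 1 (k + 1), (sigmaTwo j : ℝ) := by
    rw [← sum_Icc_sq]
    refine sum_le_sum fun j hj => ?_
    rcases (mem_Icc.1 hj).1.eq_or_lt with rfl | h
    · simp [sigmaTwo]
    · linarith [le_sigmaTwo j h]
  have hσ := sigmaTwo_le (k + 1 + 1)
  rw [sigmaTwoSums_succ (k + 1), sum_Icc_succ_top (by omega), sigmaTwoSums_succ k]
  generalize ∑ j ∈ Icc 1 (k + 1), (sigmaTwo j : ℝ) = S at *
  push_cast at *
  rw [← hk] at *
  have ht0 : 0 < t := by linarith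
  have e1 : 5 / (4 * t) * ((t ^ 3) ^ 3 / 3) ≤ 5 / (4 * t) * S := by
    refine mul_le_mul_of_nonneg_left (le_trans ?_ hS) (by positivity)
    have : 0 ≤ t ^ 3 := by positivity
    nlinarith [sq_nonneg (t ^ 3)]
  have e2 : 5 / (4 * t) * ((t ^ 3) ^ 3 / 3) = 5 / 12 * t ^ 2 * (t ^ 3) ^ 2 := by
    field_simp; norm_num
  have e3 : 40 * (t ^ 3) ^ 2 ≤ 5 / 12 * t ^ 2 * (t ^ 3) ^ 2 :=
    mul_le_mul_of_nonneg_right (by nlinarith) (by positivity)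
  have e4 : 1 ≤ t ^ 3 := one_le_pow₀ (by linarith)
  nlinarith

theorem succ_lt_mul_exp (p : ℕ → ℝ) (hp0 : p 0 = 1)
    (hrec : ∀ n : ℕ, 1 ≤ n →
      (n : ℝ) * p n = ∑ j ∈ Icc 1 n, (sigmaTwo j : ℝ) * p (n - j))
    (n : ℕ) (hn : 2 ≤ n) (hpn : 0 < p n) (t : ℝ) (ht : 10 ≤ t) (htn : t ^ 3 = n) :
    p (n + 1) < p n * Real.exp (19 / 10 / t) := by
  have ht0 : 0 < t := by linarith
  obtain ⟨k, rfl⟩ : ∃ k, n = k + 1 := ⟨n - 1, by omega⟩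
  have h := succ_mul_le_of_sigmaTwoSums p hp0 hrec
    (fun k => (1 + 5 / (4 * t)) * sigmaTwoSums k +
      (609 / 1000 * t ^ 2 + 19 / 10 * t + 2) * (k + 1) - sigmaTwoSums (k + 1))
    (5 / (4 * t)) (609 / 1000 * t ^ 2 + 19 / 10 * t + 2) (fun _ => rfl) (k + 1) hn
    (ratio_defect_nonneg t ht)
    (ratio_defect_mono t ht k (by rw [htn]; push_cast; rfl) _ (by positivity))
  rw [← htn] at h
  have h1 : (1 + 5 / (4 * t)) * t ^ 3 = t ^ 3 + 5 / 4 * t ^ 2 := by field_simp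
  rw [h1] at h
  have hz : 0 ≤ 19 / 10 / t := by positivity
  have hexp := Real.sum_le_exp_of_nonneg hz 4
  norm_num [sum_range_succ, Nat.factorial] at hexp
  have h2 : (t ^ 3 + 1) * (1 + 19 / 10 / t + (19 / 10 / t) ^ 2 / 2 + (19 / 10 / t) ^ 3 / 6) ≥
      t ^ 3 + 19 / 10 * t ^ 2 + 361 / 200 * t := by
    have : t ^ 3 * (1 + 19 / 10 / t + (19 / 10 / t) ^ 2 / 2 + (19 / 10 / t) ^ 3 / 6) =
      t ^ 3 + 19 / 10 * t ^ 2 + 361 / 200 * t + 6859 / 6000 := by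
      field_simp; ring
    rw [add_mul, this, one_mul]
    have : 0 ≤ 19 / 10 / t + (19 / 10 / t) ^ 2 / 2 + (19 / 10 / t) ^ 3 / 6 := by positivity
    linarith
  have ht3 : 0 < t ^ 3 + 1 := by positivity
  have h3 : t ^ 3 + 5 / 4 * t ^ 2 + (609 / 1000 * t ^ 2 + 19 / 10 * t + 2) <
      (t ^ 3 + 1) * Real.exp (19 / 10 / t) := by
    have := mul_le_mul_of_nonneg_left hexp ht3.le
    norm_num at h2 this
    nlinarith
  have h4 := mul_lt_mul_of_pos_right h3 hpn
  refine lt_of_mul_lt_mul_left (a := t ^ 3 + 1) ?_ ht3.le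
  linarith

theorem hasSum_sq_mul_geometric {r : ℝ} (h0 : 0 ≤ r) (h1 : r < 1) :
    HasSum (fun d : ℕ => (d : ℝ) ^ 2 * r ^ d) (r * (1 + r) / (1 - r) ^ 3) := by
  have hr : ‖r‖ < 1 := by rwa [Real.norm_of_nonneg h0]
  have h := (((hasSum_choose_mul_geometric_of_norm_lt_one 2 hr).mul_left 2).sub
    ((hasSum_choose_mul_geometric_of_norm_lt_one 1 hr).mul_left 3)).add
    (hasSum_choose_mul_geometric_of_norm_lt_one 0 hr)
  have hs : 1 - r ≠ 0 := by linarith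
  have e : r * (1 + r) / (1 - r) ^ 3 = 2 * (1 / (1 - r) ^ (2 + 1)) -
      3 * (1 / (1 - r) ^ (1 + 1)) + 1 / (1 - r) ^ (0 + 1) := by
    field_simp
    ring
  rw [e]
  refine (congrArg (fun f : ℕ → ℝ => HasSum f _) (funext fun d => ?_)).mpr h
  have hd : (d.factorial : ℝ) ≠ 0 := by positivity
  simp only [← Nat.choose_symm_add (a := d), Nat.cast_add_choose, Nat.factorial_succ,
    Nat.factorial_zero]
  push_cast
  field_simp
  ring_nf

theorem hasSum_pow_four_mul_geometric {r : ℝ} (h0 : 0 ≤ r) (h1 : r < 1) :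
    HasSum (fun d : ℕ => (d : ℝ) ^ 4 * r ^ d)
      (r * (1 + 11 * r + 11 * r ^ 2 + r ^ 3) / (1 - r) ^ 5) := by
  have hr : ‖r‖ < 1 := by rwa [Real.norm_of_nonneg h0]
  have h := ((((hasSum_choose_mul_geometric_of_norm_lt_one 4 hr).mul_left 24).sub
    ((hasSum_choose_mul_geometric_of_norm_lt_one 3 hr).mul_left 60)).add
    ((hasSum_choose_mul_geometric_of_norm_lt_one 2 hr).mul_left 50)).sub
    ((hasSum_choose_mul_geometric_of_norm_lt_one 1 hr).mul_left 15) |>.add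
    (hasSum_choose_mul_geometric_of_norm_lt_one 0 hr)
  have hs : 1 - r ≠ 0 := by linarith
  have e : r * (1 + 11 * r + 11 * r ^ 2 + r ^ 3) / (1 - r) ^ 5 =
      24 * (1 / (1 - r) ^ (4 + 1)) - 60 * (1 / (1 - r) ^ (3 + 1)) +
        50 * (1 / (1 - r) ^ (2 + 1)) - 15 * (1 / (1 - r) ^ (1 + 1)) + 1 / (1 - r) ^ (0 + 1) := by
    field_simp
    ring
  rw [e]
  refine (congrArg (fun f : ℕ → ℝ => HasSum f _) (funext fun d => ?_)).mpr h
  have hd : (d.factorial : ℝ) ≠ 0 := by positivity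
  simp only [← Nat.choose_symm_add (a := d), Nat.cast_add_choose, Nat.factorial_succ,
    Nat.factorial_zero]
  push_cast
  field_simp
  ring_nf

theorem one_sub_exp_neg_bounds {y : ℝ} (h0 : 0 < y) (h1 : y ≤ 127 / 500) :
    y - y ^ 2 / 2 ≤ 1 - Real.exp (-y) ∧ 1 - Real.exp (-y) ≤ y - y ^ 2 / 2 + y ^ 3 / 6 := by
  have h := Real.exp_bound (x := -y) (by rw [abs_neg, abs_of_pos h0]; linarith) (n := 5)
    (by norm_num)
  rw [abs_neg, abs_of_pos h0, abs_le] at h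
  norm_num [sum_range_succ, Nat.factorial] at h
  have h4 : 0 < y ^ 4 := by positivity
  have h3 : 0 < y ^ 3 := by positivity
  have h5 : y ^ 5 ≤ 127 / 500 * y ^ 4 := by nlinarith
  have h6 : y ^ 4 ≤ 127 / 500 * y ^ 3 := by nlinarith
  have e3 : (-y) ^ 3 = -y ^ 3 := by ring
  rw [e3] at h
  constructor <;> linarith [h.1, h.2]

theorem le_sum_sq_exp {y : ℝ} (h0 : 0 < y) (h1 : y ≤ 127 / 500) :
    39 / 20 / y ^ 3 ≤ Real.exp (-y) * (1 + Real.exp (-y)) / (1 - Real.exp (-y)) ^ 3 := by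
  obtain ⟨ha, hb⟩ := one_sub_exp_neg_bounds h0 h1
  obtain ⟨s, hs⟩ : ∃ s, s = 1 - Real.exp (-y) := ⟨_, rfl⟩
  have hr : Real.exp (-y) = 1 - s := by linarith
  rw [← hs] at ha hb
  rw [← hs, hr]
  have hs0 : 0 < s := by nlinarith
  obtain ⟨q, hq⟩ : ∃ q, s = y * q := ⟨s / y, by field_simp⟩
  have hq0 : 1 - y / 2 ≤ q := by
    refine le_of_mul_le_mul_left ?_ h0
    linarith
  have hq1 : q ≤ 1 - y / 2 + y ^ 2 / 6 := by
    refine le_of_mul_le_mul_left ?_ h0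
    linarith
  have hq3 : q ^ 3 ≤ (1 - y / 2 + y ^ 2 / 6) ^ 3 :=
    pow_le_pow_left₀ (by linarith) hq1 3
  have key : 39 / 20 * q ^ 3 ≤ (1 - s) * (1 + (1 - s)) := by
    have hs2 : (y - y ^ 2 / 2) ^ 2 ≤ s ^ 2 := pow_le_pow_left₀ (by nlinarith) ha 2
    have hy3 : 0 ≤ y ^ 3 := by positivity
    have : 39 / 20 * (1 - y / 2 + y ^ 2 / 6) ^ 3 ≤
        2 - 3 * (y - y ^ 2 / 2 + y ^ 3 / 6) + (y - y ^ 2 / 2) ^ 2 := by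
      have h2 : y ^ 2 ≤ (127 / 500) ^ 2 := pow_le_pow_left₀ h0.le h1 2
      have h3 : y ^ 3 ≤ (127 / 500) ^ 2 * y := by nlinarith
      have h4 : 0 < y ^ 4 := by positivity
      have h5 : y ^ 5 ≤ y ^ 4 := pow_le_pow_of_le_one h0.le (by linarith) (by norm_num)
      have h6 : y ^ 6 ≤ y ^ 4 := pow_le_pow_of_le_one h0.le (by linarith) (by norm_num)
      nlinarith
    nlinarith
  rw [div_le_div_iff₀ (by positivity) (by positivity)]
  calc 39 / 20 * s ^ 3 = 39 / 20 * q ^ 3 * y ^ 3 := by rw [hq]; ring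
    _ ≤ _ := mul_le_mul_of_nonneg_right key (by positivity)

theorem sum_pow_four_exp_le {y : ℝ} (h0 : 0 < y) (h1 : y ≤ 127 / 500) :
    Real.exp (-y) * (1 + 11 * Real.exp (-y) + 11 * Real.exp (-y) ^ 2 + Real.exp (-y) ^ 3) /
      (1 - Real.exp (-y)) ^ 5 ≤ 28 / y ^ 5 := by
  obtain ⟨ha, -⟩ := one_sub_exp_neg_bounds h0 h1
  have hw : 0 < y - y ^ 2 / 2 := by nlinarith
  have hr0 := Real.exp_pos (-y)
  have hr : Real.exp (-y) ≤ 1 - (y - y ^ 2 / 2) := by linarith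
  have hn : Real.exp (-y) * (1 + 11 * Real.exp (-y) + 11 * Real.exp (-y) ^ 2 +
      Real.exp (-y) ^ 3) ≤ 28 * (1 - y / 2) ^ 5 := by
    calc _ ≤ (1 - (y - y ^ 2 / 2)) * (1 + 11 * (1 - (y - y ^ 2 / 2)) +
          11 * (1 - (y - y ^ 2 / 2)) ^ 2 + (1 - (y - y ^ 2 / 2)) ^ 3) := by
          have : 0 ≤ 1 - (y - y ^ 2 / 2) := by linarith
          gcongr
      _ ≤ _ := by
        have h2 : y ^ 2 ≤ (127 / 500) ^ 2 := pow_le_pow_left₀ h0.le h1 2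
        have h3 : y ^ 3 ≤ (127 / 500) ^ 2 * y := by nlinarith
        have h4 : 0 < y ^ 4 := by positivity
        have h5 : y ^ 5 ≤ y ^ 4 := pow_le_pow_of_le_one h0.le (by linarith) (by norm_num)
        have h6 : y ^ 6 ≤ y ^ 4 := pow_le_pow_of_le_one h0.le (by linarith) (by norm_num)
        have h7 : y ^ 7 ≤ y ^ 4 := pow_le_pow_of_le_one h0.le (by linarith) (by norm_num)
        have h8 : y ^ 8 ≤ y ^ 4 := pow_le_pow_of_le_one h0.le (by linarith) (by norm_num)
        have h7' : 0 < y ^ 7 := by positivity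
        nlinarith
  have hd : (y * (1 - y / 2)) ^ 5 ≤ (1 - Real.exp (-y)) ^ 5 :=
    pow_le_pow_left₀ (by nlinarith) (by linarith) 5
  have hy2 : 0 < 1 - y / 2 := by linarith
  refine (div_le_div₀ (by positivity) hn (by positivity) hd).trans (le_of_eq ?_)
  have hy3 : 2 - y ≠ 0 := by linarith
  field_simp

theorem le_sum_Icc_sq_mul_exp {y c : ℝ} (h0 : 0 < y) (h1 : y ≤ 127 / 500) (hc : 0 ≤ c) (D : ℕ)
    (hD : ∀ d : ℕ, D < d → 1 ≤ c * (d : ℝ) ^ 2) :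
    39 / 20 / y ^ 3 - c * (28 / y ^ 5) ≤
      ∑ d ∈ Icc 1 D, (d : ℝ) ^ 2 * (Real.exp (-(d * y)) * (1 - c * (d : ℝ) ^ 2)) := by
  have hr0 := (Real.exp_pos (-y)).le
  have hr1 : Real.exp (-y) < 1 := by rw [Real.exp_lt_one_iff]; linarith
  have h := ((hasSum_pow_four_mul_geometric hr0 hr1).mul_left c).sub
    (hasSum_sq_mul_geometric hr0 hr1)
  have hle := sum_le_hasSum (Icc 1 D) (fun d hd => ?_) h
  · have e : ∑ d ∈ Icc 1 D, (d : ℝ) ^ 2 * (Real.exp (-(d * y)) * (1 - c * (d : ℝ) ^ 2)) =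
        -∑ d ∈ Icc 1 D, (c * ((d : ℝ) ^ 4 * Real.exp (-y) ^ d) -
          (d : ℝ) ^ 2 * Real.exp (-y) ^ d) := by
      rw [← sum_neg_distrib]
      refine sum_congr rfl fun d _ => ?_
      rw [← mul_neg, Real.exp_nat_mul]
      ring
    rw [e]
    have := mul_le_mul_of_nonneg_left (sum_pow_four_exp_le h0 h1) hc
    linarith [le_sum_sq_exp h0 h1]
  · rcases Nat.eq_zero_or_pos d with rfl | hd0
    · simp
    · have h2 := hD d (by by_contra hcon; exact hd (mem_Icc.2 ⟨hd0, not_lt.1 hcon⟩))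
      have h3 : c * ((d : ℝ) ^ 4 * Real.exp (-y) ^ d) - (d : ℝ) ^ 2 * Real.exp (-y) ^ d =
          (d : ℝ) ^ 2 * Real.exp (-y) ^ d * (c * (d : ℝ) ^ 2 - 1) := by ring
      rw [h3]
      exact mul_nonneg (by positivity) (by linarith)

theorem sq_ge_of_cube_eq {t u j : ℝ} (ht : 0 < t) (hu : u ^ 3 = t ^ 3 - j) :
    t ^ 2 - 2 / 3 * j / t - 1 / 3 * j ^ 2 / t ^ 4 ≤ u ^ 2 := by
  obtain rfl : j = t ^ 3 - u ^ 3 := by linarith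
  have e : u ^ 2 - (t ^ 2 - 2 / 3 * (t ^ 3 - u ^ 3) / t - 1 / 3 * (t ^ 3 - u ^ 3) ^ 2 / t ^ 4) =
      u ^ 2 * (t - u) ^ 2 * (2 * t ^ 2 + (t + u) ^ 2) / (3 * t ^ 4) := by
    field_simp
    ring
  have : 0 ≤ u ^ 2 * (t - u) ^ 2 * (2 * t ^ 2 + (t + u) ^ 2) / (3 * t ^ 4) := by positivity
  linarith

theorem exists_cube_eq (n : ℕ) : ∃ t : ℝ, 0 ≤ t ∧ t ^ 3 = n :=
  ⟨(n : ℝ) ^ ((3 : ℕ) : ℝ)⁻¹, by positivity,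
    Real.rpow_inv_natCast_pow (by positivity) (by norm_num)⟩

theorem exp_mul_le_of_forall_lt (p : ℕ → ℝ) (hp : ∀ n, 0 ≤ p n) (n : ℕ) (t : ℝ) (ht : 10 ≤ t)
    (htn : t ^ 3 = n)
    (ih : ∀ k : ℕ, 874 ≤ k → k < n → ∀ u : ℝ, 0 ≤ u → u ^ 3 = k →
      Real.exp (19 / 10 * u ^ 2) ≤ p k)
    (j : ℕ) (hj : 1 ≤ j) (hjn : j ≤ n) :
    Real.exp (19 / 10 * t ^ 2) *
      (Real.exp (-(j * (19 / 15 / t))) * (1 - 19 / 30 / t ^ 4 * (j : ℝ) ^ 2)) ≤ p (n - j) := by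
  have ht0 : 0 < t := by linarith
  rcases le_or_gt 1 (19 / 30 / t ^ 4 * (j : ℝ) ^ 2) with hc | hc
  · refine le_trans ?_ (hp _)
    exact mul_nonpos_of_nonneg_of_nonpos (by positivity)
      (mul_nonpos_of_nonneg_of_nonpos (by positivity) (by linarith))
  · have hj2 : (j : ℝ) ≤ 12566 / 10000 * t ^ 2 := by
      rw [div_mul_eq_mul_div, div_lt_one (by positivity)] at hc
      refine le_of_sq_le_sq ?_ (by positivity)
      nlinarith
    have hnj : 874 ≤ n - j := by
      have : (j : ℝ) + 874 ≤ n := by rw [← htn]; nlinarith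
      have : j + 874 ≤ n := by exact_mod_cast this
      omega
    obtain ⟨u, hu0, hu⟩ := exists_cube_eq (n - j)
    refine le_trans ?_ (ih (n - j) hnj (by omega) u hu0 hu)
    have h := sq_ge_of_cube_eq (j := j) ht0 (by rw [hu, htn, Nat.cast_sub hjn])
    have h1 := Real.add_one_le_exp (-(19 / 30 / t ^ 4 * (j : ℝ) ^ 2))
    calc _ ≤ Real.exp (19 / 10 * t ^ 2) * (Real.exp (-(j * (19 / 15 / t))) *
          Real.exp (-(19 / 30 / t ^ 4 * (j : ℝ) ^ 2))) := by
          gcongr; linarith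
      _ ≤ _ := by
          rw [← Real.exp_add, ← Real.exp_add, Real.exp_le_exp]
          have e : 19 / 10 * t ^ 2 + (-(j * (19 / 15 / t)) + -(19 / 30 / t ^ 4 * (j : ℝ) ^ 2)) =
            19 / 10 * (t ^ 2 - 2 / 3 * j / t - 1 / 3 * j ^ 2 / t ^ 4) := by ring
          rw [e]
          linarith

theorem exp_le_of_forall_lt (p : ℕ → ℝ) (hp : ∀ n, 0 ≤ p n)
    (hrec : ∀ n : ℕ, 1 ≤ n →
      (n : ℝ) * p n = ∑ j ∈ Icc 1 n, (sigmaTwo j : ℝ) * p (n - j))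
    (n : ℕ) (t : ℝ) (ht : 10 ≤ t) (htn : t ^ 3 = n)
    (ih : ∀ k : ℕ, 874 ≤ k → k < n → ∀ u : ℝ, 0 ≤ u → u ^ 3 = k →
      Real.exp (19 / 10 * u ^ 2) ≤ p k) :
    Real.exp (19 / 10 * t ^ 2) ≤ p n := by
  have ht0 : 0 < t := by linarith
  have hn2 : 2 ≤ n := by
    have : (2 : ℝ) ≤ n := by
      rw [← htn]
      nlinarith [pow_le_pow_left₀ (by norm_num) ht 3]
    exact_mod_cast this
  obtain ⟨P, hP⟩ : ∃ P, P = Real.exp (19 / 10 * t ^ 2) := ⟨_, rfl⟩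
  have hP0 : 0 < P := by rw [hP]; positivity
  have inner (m : ℕ) (hm : 1 ≤ m) (hm2 : m ≤ 2) :
      P * (39 / 20 / (m * (19 / 15 / t)) ^ 3 -
        19 / 30 / t ^ 4 * m ^ 2 * (28 / (m * (19 / 15 / t)) ^ 5)) ≤
        ∑ d ∈ Icc 1 (n / m), (d : ℝ) ^ 2 * p (n - m * d) := by
    have hm0 : (1 : ℝ) ≤ m := by exact_mod_cast hm
    have hm2' : (m : ℝ) ≤ 2 := by exact_mod_cast hm2
    have hx : 19 / 15 / t ≤ 127 / 1000 := by
      rw [div_le_iff₀ ht0]; linarith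
    have h := le_sum_Icc_sq_mul_exp (y := m * (19 / 15 / t)) (c := 19 / 30 / t ^ 4 * m ^ 2)
      (by positivity) (by nlinarith) (by positivity) (n / m) (fun d hd => ?_)
    · refine (mul_le_mul_of_nonneg_left h hP0.le).trans ?_
      rw [mul_sum]
      refine sum_le_sum fun d hd => ?_
      have hd' := mem_Icc.1 hd
      have h2 := exp_mul_le_of_forall_lt p hp n t ht htn ih (m * d)
        (Nat.mul_pos hm hd'.1) ((Nat.mul_comm _ _).trans_le (Nat.mul_le_of_le_div _ _ _ hd'.2))
      have h3 := mul_le_mul_of_nonneg_left h2 (sq_nonneg (d : ℝ))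
      refine le_trans (le_of_eq ?_) h3
      rw [← hP]
      push_cast
      rw [show (m : ℝ) * d * (19 / 15 / t) = d * (m * (19 / 15 / t)) by ring]
      ring
    · have h2 : n < d * m := (Nat.div_lt_iff_lt_mul hm).1 hd
      have h3 : t ^ 3 ≤ d * m := by rw [htn]; exact_mod_cast h2.le
      have h4 : (t ^ 3) ^ 2 ≤ (d * m : ℝ) ^ 2 := pow_le_pow_left₀ (by positivity) h3 2
      calc (1 : ℝ) ≤ 19 / 30 / t ^ 4 * (t ^ 3) ^ 2 := by
            have : 19 / 30 / t ^ 4 * (t ^ 3) ^ 2 = 19 / 30 * t ^ 2 := by field_simp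
            rw [this]; nlinarith
        _ ≤ 19 / 30 / t ^ 4 * (d * m : ℝ) ^ 2 := by gcongr
        _ = _ := by ring
  have hsum : ∑ m ∈ {1, 2}, ∑ d ∈ Icc 1 (n / m), (d : ℝ) ^ 2 * p (n - m * d) ≤ n * p n := by
    rw [hrec n (by omega), sum_sigmaTwo_mul n (fun j => p (n - j))]
    refine sum_le_sum_of_subset_of_nonneg (fun m hm => ?_) fun m _ _ =>
      sum_nonneg fun d _ => mul_nonneg (sq_nonneg _) (hp _)
    rw [mem_insert, mem_singleton] at hm
    rw [mem_Icc]
    omega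
  rw [sum_pair (by norm_num)] at hsum
  have h1 := inner 1 le_rfl (by norm_num)
  have h2 := inner 2 (by norm_num) le_rfl
  have h3 : P * (39 / 20 / ((1 : ℕ) * (19 / 15 / t)) ^ 3 -
        19 / 30 / t ^ 4 * (1 : ℕ) ^ 2 * (28 / ((1 : ℕ) * (19 / 15 / t)) ^ 5)) +
      P * (39 / 20 / ((2 : ℕ) * (19 / 15 / t)) ^ 3 -
        19 / 30 / t ^ 4 * (2 : ℕ) ^ 2 * (28 / ((2 : ℕ) * (19 / 15 / t)) ^ 5)) =
      P * (9 / 8 * (39 / 20 * (15 / 19) ^ 3 * t ^ 3 - 19 / 30 * 28 * (15 / 19) ^ 5 * t)) := by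
    push_cast
    field_simp
    ring
  have h4 : t ^ 3 ≤
      9 / 8 * (39 / 20 * (15 / 19) ^ 3 * t ^ 3 - 19 / 30 * 28 * (15 / 19) ^ 5 * t) := by
    have : 100 * t ≤ t ^ 3 := by nlinarith
    norm_num
    linarith
  have h5 := mul_le_mul_of_nonneg_left h4 hP0.le
  rw [← htn] at hsum
  rw [← hP]
  refine le_of_mul_le_mul_left ?_ (by positivity : 0 < t ^ 3)
  linarith

theorem exp_le_of_base (p : ℕ → ℝ) (hp : ∀ n, 0 ≤ p n)
    (hrec : ∀ n : ℕ, 1 ≤ n →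
      (n : ℝ) * p n = ∑ j ∈ Icc 1 n, (sigmaTwo j : ℝ) * p (n - j))
    (hbase : ∀ k : ℕ, 874 ≤ k → k < 1000 → ∀ u : ℝ, 0 ≤ u → u ^ 3 = k →
      Real.exp (19 / 10 * u ^ 2) ≤ p k) (n : ℕ) :
    874 ≤ n → ∀ t : ℝ, 0 ≤ t → t ^ 3 = n → Real.exp (19 / 10 * t ^ 2) ≤ p n := by
  induction n using Nat.strong_induction_on with
  | _ n ih =>
    intro hn t ht htn
    rcases lt_or_ge n 1000 with h | h
    · exact hbase n hn h t ht htn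
    · refine exp_le_of_forall_lt p hp hrec n t ?_ htn fun k hk hkn => ih k hkn hk
      refine le_of_pow_le_pow_left₀ (n := 3) (by norm_num) ht ?_
      rw [htn]
      have : (1000 : ℝ) ≤ n := by exact_mod_cast h
      linarith

/-- Applies `f` to `x` by recursion on `x`, so that the kernel evaluates `x` to a numeral first. -/
def applyForced {α : Type} (x : ℕ) (f : ℕ → α) : α :=
  Nat.rec (f 0) (fun k _ => f (Nat.succ k)) x

def sumBelow (f : ℕ → ℕ) : ℕ → ℕ
  | 0 => 0
  | n + 1 => sumBelow f n + f n

/-- The generating polynomial of `sigmaTwo`, evaluated at `X`. -/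
def packedSigmaTwo (X N : ℕ) : ℕ :=
  sumBelow (fun d => (d + 1) ^ 2 *
    sumBelow (fun k => X ^ (d + (d + 1) * k)) (N / (d + 1))) N

def rootTest (n x y : ℕ) : Bool :=
  (Nat.ble n 5 || Nat.ble (y ^ n + 1) (x ^ (n + 1))) &&
    (Nat.ble n 873 ||
      (Nat.ble (6859 * n ^ 2) (1000 * (190 - (1000 - n) / 8) ^ 3) &&
        Nat.ble (27183 ^ (190 - (1000 - n) / 8)) (10000 ^ (190 - (1000 - n) / 8) * x)))

/-- Runs the recursion for plane partition numbers, with the pending sums packed into the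
base `X` digits of `A`, and tests consecutive values. -/
def recursionTest (X M S : ℕ) : ℕ → ℕ → ℕ → ℕ → ℕ → Bool
  | 0, _, _, _, _ => true
  | k + 1, n, x, q, A =>
    applyForced (n + 1) fun n' => applyForced (A % X / n') fun y =>
      applyForced (q + y) fun q' => applyForced (A / X + y * S) fun A' =>
        Nat.ble (q * M + 1) X && Nat.beq (y * n') (A % X) && rootTest n x y &&
          recursionTest X M S k n' y q' A'

theorem applyForced_eq {α : Type} (x : ℕ) (f : ℕ → α) : applyForced x f = f x := by
  cases x <;> rfl

theorem sumBelow_eq (f : ℕ → ℕ) (n : ℕ) : sumBelow f n = ∑ i ∈ range n, f i := by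
  induction n with
  | zero => rfl
  | succ n ih => rw [sumBelow, ih, sum_range_succ]

theorem sum_Icc_one_eq_sum_range {M : Type*} [AddCommMonoid M] (g : ℕ → M) (N : ℕ) :
    ∑ j ∈ Icc 1 N, g j = ∑ j ∈ range N, g (j + 1) := by
  induction N with
  | zero => simp
  | succ N ih => rw [sum_Icc_succ_top (by omega), sum_range_succ, ih]

theorem packedSigmaTwo_eq (X N : ℕ) :
    packedSigmaTwo X N = ∑ j ∈ range N, sigmaTwo (j + 1) * X ^ j := by
  have h := sum_Icc_sum_divisorsAntidiagonal (fun d k => d ^ 2 * X ^ (d * k - 1)) N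
  have h1 : ∀ j ∈ Icc 1 N, ∑ x ∈ j.divisorsAntidiagonal, x.1 ^ 2 * X ^ (x.1 * x.2 - 1) =
      sigmaTwo j * X ^ (j - 1) := fun j _ => by
    rw [sigmaTwo, ← Nat.sum_divisorsAntidiagonal (fun d _ => d ^ 2), sum_mul]
    refine sum_congr rfl fun x hx => ?_
    rw [(Nat.mem_divisorsAntidiagonal.1 hx).1]
  rw [sum_congr rfl h1, sum_Icc_one_eq_sum_range] at h
  simp only [Nat.add_sub_cancel] at h
  rw [h, sum_Icc_one_eq_sum_range, packedSigmaTwo, sumBelow_eq]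
  refine sum_congr rfl fun d _ => ?_
  rw [sumBelow_eq, sum_Icc_one_eq_sum_range, mul_sum]
  refine sum_congr rfl fun k _ => ?_
  rw [show (d + 1) * (k + 1) - 1 = d + (d + 1) * k by
    rw [mul_add, mul_one]; omega]

def truncatedSigmaTwo (N j : ℕ) : ℕ := if j ≤ N then sigmaTwo j else 0

theorem recursionTest_sound (p : ℕ → ℝ)
    (hrec : ∀ n : ℕ, 1 ≤ n →
      (n : ℝ) * p n = ∑ j ∈ Icc 1 n, (sigmaTwo j : ℝ) * p (n - j))
    (X M N : ℕ) (hM : ∀ j ≤ N, sigmaTwo j ≤ M) (f : ℕ → ℕ) (hf : ∀ i, f i = ⌊p i⌋₊) (k : ℕ) :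
    ∀ n x q A, n + k ≤ N → (∀ i ≤ n, p i = f i) → x = f n → q = ∑ i ∈ range (n + 1), f i →
      A = ∑ j ∈ range N, (∑ i ∈ range (n + 1), f i * truncatedSigmaTwo N (n - i + j + 1)) * X ^ j →
      recursionTest X M (packedSigmaTwo X N) k n x q A = true →
      ∀ m, n ≤ m → m < n + k →
        p m = f m ∧ p (m + 1) = f (m + 1) ∧ rootTest m (f m) (f (m + 1)) = true := by
  induction k with
  | zero => intros; omega
  | succ k ih =>
    intro n x q A hnk hp hx hq hA htest m hnm hmk
    simp only [recursionTest, applyForced_eq, Bool.and_eq_true, Nat.ble_eq, Nat.beq_eq] at htest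
    obtain ⟨⟨⟨hX, hy⟩, hroot⟩, hnext⟩ := htest
    set y := A % X / (n + 1)
    obtain ⟨c, hc⟩ : ∃ c : ℕ → ℕ, ∀ j, c j =
      ∑ i ∈ range (n + 1), f i * truncatedSigmaTwo N (n - i + j + 1) := ⟨_, fun _ => rfl⟩
    simp only [← hc] at hA
    have hcN : c N = 0 := by
      rw [hc]
      refine sum_eq_zero fun i _ => ?_
      rw [truncatedSigmaTwo, if_neg (by omega), mul_zero]
    have hA1 : A = c 0 + X * ∑ j ∈ range N, c (j + 1) * X ^ j := by
      have h1 := sum_range_succ (fun j => c j * X ^ j) N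
      rw [hcN, zero_mul, add_zero, sum_range_succ'] at h1
      rw [hA, ← h1, mul_sum, pow_zero, mul_one, add_comm]
      congr 1
      refine sum_congr rfl fun j _ => ?_
      ring
    have hc0 : c 0 < X := by
      refine lt_of_le_of_lt ?_ hX
      rw [hc, hq, sum_mul]
      refine sum_le_sum fun i _ => Nat.mul_le_mul_left _ ?_
      rw [truncatedSigmaTwo]
      split_ifs with h
      · exact hM _ h
      · exact Nat.zero_le _
    have hmod : A % X = c 0 := by
      rw [hA1, Nat.add_mul_mod_self_left, Nat.mod_eq_of_lt hc0]
    have hdiv : A / X = ∑ j ∈ range N, c (j + 1) * X ^ j := by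
      rw [hA1, Nat.add_mul_div_left _ _ (by omega), Nat.div_eq_of_lt hc0, zero_add]
    have hpy : p (n + 1) = y := by
      have h1 := hrec (n + 1) (by omega)
      rw [sum_Icc_one_eq_sum_range, ← sum_range_reflect] at h1
      have h2 : ∑ j ∈ range (n + 1), (sigmaTwo (n + 1 - 1 - j + 1) : ℝ) *
          p (n + 1 - (n + 1 - 1 - j + 1)) = c 0 := by
        rw [hc, Nat.cast_sum]
        refine sum_congr rfl fun j hj => ?_
        have hj' := mem_range.1 hj
        rw [truncatedSigmaTwo, if_pos (by omega), show n + 1 - (n + 1 - 1 - j + 1) = j by omega,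
          hp j (by omega), mul_comm, Nat.cast_mul]
        rfl
      rw [h2, ← hmod, ← hy, mul_comm, Nat.cast_mul] at h1
      exact mul_right_cancel₀ (by positivity) h1
    have hfy : f (n + 1) = y := by rw [hf, hpy, Nat.floor_natCast]
    rcases hnm.eq_or_lt with rfl | hlt
    · exact ⟨hp _ le_rfl, by rw [hpy, hfy], by rw [hfy, ← hx]; exact hroot⟩
    · refine ih (n + 1) y (q + y) (A / X + y * packedSigmaTwo X N) (by omega) (fun i hi => ?_)
        hfy.symm ?_ ?_ hnext m hlt (by omega)
      · rcases Nat.le_succ_iff.1 hi with h | rfl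
        · exact hp i h
        · rw [hpy, hfy]
      · rw [sum_range_succ _ (n + 1), hq, hfy]
      · rw [hdiv, packedSigmaTwo_eq, mul_sum, ← sum_add_distrib]
        refine sum_congr rfl fun j hj => ?_
        rw [sum_range_succ _ (n + 1), hc, add_mul, hfy, truncatedSigmaTwo,
          if_pos (by have := mem_range.1 hj; omega), Nat.sub_self, zero_add, mul_assoc]
        congr 2
        refine sum_congr rfl fun i hi => ?_
        rw [show n - i + (j + 1) + 1 = n + 1 - i + j + 1 by have := mem_range.1 hi; omega]

theorem recursionTest_eq_true :
    recursionTest (2 ^ 320) 2000000 (packedSigmaTwo (2 ^ 320) 1000) 1000 0 1 1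
      (packedSigmaTwo (2 ^ 320) 1000) = true := by
  have h : (applyForced (packedSigmaTwo (2 ^ 320) 1000) fun S =>
    recursionTest (2 ^ 320) 2000000 S 1000 0 1 1 S) = true := by decide +kernel
  rwa [applyForced_eq] at h

theorem rootTest_of_lt (p : ℕ → ℝ) (hp0 : p 0 = 1)
    (hrec : ∀ n : ℕ, 1 ≤ n →
      (n : ℝ) * p n = ∑ j ∈ Icc 1 n, (sigmaTwo j : ℝ) * p (n - j)) (n : ℕ) (hn : n < 1000) :
    ∃ x y : ℕ, p n = x ∧ p (n + 1) = y ∧ rootTest n x y = true := by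
  have hf0 : ⌊p 0⌋₊ = 1 := by rw [hp0, Nat.floor_one]
  refine ⟨⌊p n⌋₊, ⌊p (n + 1)⌋₊, recursionTest_sound p hrec (2 ^ 320) 2000000 1000 (fun j hj => ?_)
    (fun i => ⌊p i⌋₊) (fun _ => rfl) 1000 0 1 1 (packedSigmaTwo (2 ^ 320) 1000) le_rfl
    (fun i hi => ?_) hf0.symm ?_ ?_ recursionTest_eq_true n (Nat.zero_le _) (by omega)⟩
  · have h1 := sigmaTwo_le j
    have h2 : (j : ℝ) ≤ 1000 := by exact_mod_cast hj
    have h3 : (sigmaTwo j : ℝ) ≤ 2000000 := by nlinarith [Nat.cast_nonneg (α := ℝ) j]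
    exact_mod_cast h3
  · rw [Nat.le_zero.1 hi, hf0, hp0, Nat.cast_one]
  · rw [sum_range_one, hf0]
  · rw [packedSigmaTwo_eq]
    refine sum_congr rfl fun j hj => ?_
    rw [sum_range_one, hf0, one_mul, truncatedSigmaTwo, if_pos (by have := mem_range.1 hj; omega),
      Nat.sub_self, zero_add]

theorem exp_le_of_lt (p : ℕ → ℝ) (hp0 : p 0 = 1)
    (hrec : ∀ n : ℕ, 1 ≤ n →
      (n : ℝ) * p n = ∑ j ∈ Icc 1 n, (sigmaTwo j : ℝ) * p (n - j))
    (n : ℕ) (hn : 874 ≤ n) (hn' : n < 1000) (t : ℝ) (htn : t ^ 3 = n) :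
    Real.exp (19 / 10 * t ^ 2) ≤ p n := by
  obtain ⟨x, y, hx, -, h⟩ := rootTest_of_lt p hp0 hrec n hn'
  simp only [rootTest, Bool.and_eq_true, Bool.or_eq_true, Nat.ble_eq] at h
  obtain ⟨h1, h2⟩ := h.2.resolve_left (by omega)
  generalize 190 - (1000 - n) / 8 = k at h1 h2
  have h3 : 19 / 10 * t ^ 2 ≤ k := by
    refine le_of_pow_le_pow_left₀ (n := 3) (by norm_num) (by positivity) ?_
    have h4 : 6859 * (n : ℝ) ^ 2 ≤ 1000 * (k : ℝ) ^ 3 := by exact_mod_cast h1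
    rw [← htn] at h4
    linarith
  have h5 : (27183 : ℝ) ^ k ≤ 10000 ^ k * x := by exact_mod_cast h2
  calc Real.exp (19 / 10 * t ^ 2) ≤ Real.exp k := Real.exp_le_exp.2 h3
    _ = Real.exp 1 ^ k := by rw [← Real.exp_nat_mul, mul_one]
    _ ≤ (27183 / 10000) ^ k := by
        refine pow_le_pow_left₀ (Real.exp_pos 1).le ?_ k
        linarith [Real.exp_one_lt_d9]
    _ ≤ p n := by rwa [hx, div_pow, div_le_iff₀' (by positivity)]

theorem pow_lt_pow_succ (p : ℕ → ℝ) (hp0 : p 0 = 1)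
    (hrec : ∀ n : ℕ, 1 ≤ n →
      (n : ℝ) * p n = ∑ j ∈ Icc 1 n, (sigmaTwo j : ℝ) * p (n - j))
    (n : ℕ) (hn : 6 ≤ n) : p (n + 1) ^ n < p n ^ (n + 1) := by
  rcases lt_or_ge n 1000 with h | h
  · obtain ⟨x, y, hx, hy, hxy⟩ := rootTest_of_lt p hp0 hrec n h
    simp only [rootTest, Bool.and_eq_true, Bool.or_eq_true, Nat.ble_eq] at hxy
    have h1 := hxy.1.resolve_left (by omega)
    rw [hx, hy]
    exact_mod_cast h1
  · have hp : ∀ k, 0 ≤ p k := fun k => by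
      induction k using Nat.strong_induction_on with
      | _ k ih =>
        rcases Nat.eq_zero_or_pos k with rfl | hk
        · rw [hp0]; exact zero_le_one
        · refine nonneg_of_mul_nonneg_right (a := (k : ℝ)) ?_ (by exact_mod_cast hk)
          rw [hrec k hk]
          refine sum_nonneg fun j hj => mul_nonneg (by positivity) (ih _ ?_)
          have := mem_Icc.1 hj
          omega
    obtain ⟨t, ht0, htn⟩ := exists_cube_eq n
    have ht : 10 ≤ t := by
      refine le_of_pow_le_pow_left₀ (n := 3) (by norm_num) ht0 ?_
      rw [htn]
      have : (1000 : ℝ) ≤ n := by exact_mod_cast h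
      linarith
    have hlow := exp_le_of_base p hp hrec
      (fun k hk hk' u _ => exp_le_of_lt p hp0 hrec k hk hk' u) n (by omega) t ht0 htn
    have hpn : 0 < p n := (Real.exp_pos _).trans_le hlow
    have hup := succ_lt_mul_exp p hp0 hrec n (by omega) hpn t ht htn
    calc p (n + 1) ^ n < (p n * Real.exp (19 / 10 / t)) ^ n :=
          pow_lt_pow_left₀ hup (hp _) (by omega)
      _ = p n ^ n * Real.exp (19 / 10 * t ^ 2) := by
          rw [mul_pow, ← Real.exp_nat_mul, ← htn]
          congr 2
          have : t ≠ 0 := by linarith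
          field_simp
      _ ≤ p n ^ n * p n := by gcongr
      _ = p n ^ (n + 1) := (pow_succ _ _).symm

/-- The sequence `pp(n)^(1/n)` of `n`-th roots of the plane partition numbers is
strictly decreasing for `n ≥ 6`; equivalently `pp(n)^(n+1) > pp(n+1)^n` for
`n ≥ 6`.  Here `pp` is characterized by MacMahon's recursion
`n·pp(n) = ∑_{j=1}^n σ₂(j)pp(n−j)`, `pp(0) = 1`. -/
theorem plane_partition_root_decreasing (pp : ℕ → ℚ)
    (hpp0 : pp 0 = 1)
    (hrec : ∀ n : ℕ, 1 ≤ n →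
      (n : ℚ) * pp n = ∑ j ∈ Icc 1 n, (∑ d ∈ j.divisors, (d : ℚ) ^ 2) * pp (n - j)) :
    ∀ n : ℕ, 6 ≤ n → pp n ^ (n + 1) > pp (n + 1) ^ n := by
  intro n hn
  have h := pow_lt_pow_succ (fun k => ((pp k : ℚ) : ℝ)) (by simp [hpp0]) (fun k hk => ?_) n hn
  · exact_mod_cast h
  · have := congrArg (fun q : ℚ => (q : ℝ)) (hrec k hk)
    push_cast at this
    rw [this]
    refine sum_congr rfl fun j _ => ?_
    rw [sigmaTwo]
    push_cast
    rfl
end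

section
/- For the overpartition function p̄(n), one has p̄(n)^{n+1} > p̄(n+1)^n for all n ≥ 3, with equality at n = 1 and n = 2, i.e. p̄(1)² = p̄(2) and p̄(2)³ = p̄(3)². -/
open Finset

/-- The sequence `a` satisfies `n a(n) = ∑_{j=1}^n w(j-1) a(n-j)` for all `n ≥ 1`. -/
def SatisfiesRec (w a : ℕ → ℝ) : Prop :=
  ∀ n : ℕ, (n + 1 : ℝ) * a (n + 1) = ∑ j ∈ range (n + 1), w j * a (n - j)

/-- Backward difference of a sequence extended by `0` to the left. -/
def backDiff (a : ℕ → ℝ) : ℕ → ℝ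
  | 0 => a 0
  | n + 1 => a (n + 1) - a n

theorem sum_mul_backDiff (w a : ℕ → ℝ) (n : ℕ) :
    ∑ j ∈ range (n + 2), w j * backDiff a (n + 1 - j) =
      ∑ j ∈ range (n + 2), w j * a (n + 1 - j) - ∑ j ∈ range (n + 1), w j * a (n - j) := by
  rw [sum_range_succ, sum_range_succ (fun j => w j * a (n + 1 - j)), add_sub_right_comm,
    ← sum_sub_distrib, Nat.sub_self]
  congr 1
  refine sum_congr rfl fun j hj => ?_
  have hj : j ≤ n := Nat.lt_succ_iff.mp (mem_range.mp hj)
  rw [Nat.succ_sub hj, backDiff, mul_sub]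

theorem sum_backDiff (a : ℕ → ℝ) (n : ℕ) :
    ∑ j ∈ range (n + 1), backDiff a (n - j) = a n := by
  induction n with
  | zero => simp [backDiff]
  | succ n ih =>
    rw [sum_range_succ']
    simp only [Nat.add_sub_add_right, ih]
    exact add_sub_cancel _ _

theorem sum_succ_mul_backDiff (a : ℕ → ℝ) (n : ℕ) :
    ∑ j ∈ range (n + 1), (j + 1 : ℝ) * backDiff a (n - j) = ∑ k ∈ range (n + 1), a k := by
  induction n with
  | zero => simp [backDiff]
  | succ n ih =>
    rw [sum_range_succ', sum_range_succ a, ← ih]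
    have h : ∀ j : ℕ, (((j + 1 : ℕ) : ℝ) + 1) * backDiff a (n + 1 - (j + 1)) =
        (j + 1 : ℝ) * backDiff a (n - j) + backDiff a (n - j) := fun j => by
      rw [Nat.add_sub_add_right]; push_cast; ring
    simp only [h, sum_add_distrib, sum_backDiff]
    simp [backDiff]

theorem SatisfiesRec.backDiff {w a : ℕ → ℝ} (h : SatisfiesRec w a) :
    SatisfiesRec (fun j => w j - 1) (backDiff a) := by
  intro n
  simp only [sub_mul, one_mul, sum_sub_distrib, sum_backDiff]
  cases n with
  | zero =>
    have := h 0
    simp [_root_.backDiff] at this ⊢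
    linarith
  | succ n =>
    rw [sum_mul_backDiff, ← h n, ← h (n + 1)]
    simp only [_root_.backDiff]
    push_cast
    ring

theorem SatisfiesRec.nonneg {w a : ℕ → ℝ} (h : SatisfiesRec w a) (hw : ∀ j, 0 ≤ w j)
    (h0 : 0 ≤ a 0) (n : ℕ) : 0 ≤ a n := by
  induction n using Nat.strong_induction_on with
  | _ n ih =>
    cases n with
    | zero => exact h0
    | succ n =>
      have hs : 0 ≤ (n + 1 : ℝ) * a (n + 1) := by
        rw [h n]
        exact sum_nonneg fun j _ => mul_nonneg (hw j) (ih _ (by omega))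
      exact nonneg_of_mul_nonneg_right hs (by positivity)

theorem monotone_of_backDiff_nonneg {a : ℕ → ℝ} (h : ∀ n, 0 ≤ backDiff a n) : Monotone a :=
  monotone_nat_of_le_succ fun n => sub_nonneg.mp (h (n + 1))

/-- Abel summation: an antitone weight preserves nonnegativity of partial sums. -/
theorem sum_mul_nonneg_of_antitone {v f : ℕ → ℝ} (hf : Antitone f) (hf0 : ∀ n, 0 ≤ f n)
    (hv : ∀ n, 0 ≤ ∑ j ∈ range n, v j) (n : ℕ) : 0 ≤ ∑ j ∈ range (n + 1), v j * f j := by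
  have key : f n * ∑ j ∈ range (n + 1), v j ≤ ∑ j ∈ range (n + 1), v j * f j := by
    induction n with
    | zero => simp [mul_comm]
    | succ n ih =>
      rw [sum_range_succ, sum_range_succ (fun j => v j * f j), mul_add]
      have := mul_le_mul_of_nonneg_right (hf n.le_succ) (hv (n + 1))
      linarith [mul_comm (f (n + 1)) (v (n + 1))]
  exact (mul_nonneg (hf0 n) (hv _)).trans key

/-- The sum of the divisors of `j` with odd codivisor. -/
def oddCodivisorSum (j : ℕ) : ℕ :=
  ∑ i ∈ range j, if 2 * i + 1 ∣ j then j / (2 * i + 1) else 0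

theorem sum_divisors_eq_oddCodivisorSum_add {j : ℕ} (hj : 1 ≤ j) :
    ∑ d ∈ j.divisors, d =
      oddCodivisorSum j + if 2 ∣ j then ∑ d ∈ (j / 2).divisors, d else 0 := by
  rw [← Nat.sum_div_divisors, ← sum_filter_not_add_sum_filter _ (fun d => 2 ∣ d)]
  congr 1
  · rw [oddCodivisorSum, ← sum_filter]
    refine sum_nbij' (fun d => d / 2) (fun i => 2 * i + 1) ?_ ?_ ?_ ?_ ?_
    · intro d hd
      simp only [mem_filter, Nat.mem_divisors, mem_range] at hd ⊢
      have := Nat.le_of_dvd hj hd.1.1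
      have h2 : 2 * (d / 2) + 1 = d := by omega
      exact ⟨by omega, by rw [h2]; exact hd.1.1⟩
    · intro i hi
      simp only [mem_filter, Nat.mem_divisors, mem_range] at hi ⊢
      exact ⟨⟨hi.2, by omega⟩, by omega⟩
    · intro d hd
      simp only [mem_filter] at hd
      omega
    · intro i _
      omega
    · intro d hd
      simp only [mem_filter] at hd
      rw [show 2 * (d / 2) + 1 = d by omega]
  · split_ifs with h2
    · obtain ⟨m, rfl⟩ := h2
      rw [Nat.mul_div_cancel_left m two_pos, ← Nat.sum_div_divisors]
      refine sum_nbij' (fun d => d / 2) (fun i => 2 * i) ?_ ?_ ?_ ?_ ?_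
      · intro d hd
        simp only [mem_filter, Nat.mem_divisors] at hd ⊢
        obtain ⟨⟨hd, _⟩, l, rfl⟩ := hd
        rw [Nat.mul_div_cancel_left l two_pos]
        exact ⟨(Nat.mul_dvd_mul_iff_left two_pos).mp hd, by omega⟩
      · intro i hi
        simp only [mem_filter, Nat.mem_divisors] at hi ⊢
        exact ⟨⟨Nat.mul_dvd_mul_left 2 hi.1, by omega⟩, dvd_mul_right 2 i⟩
      · intro d hd
        simp only [mem_filter] at hd
        omega
      · intro i _
        simp
      · intro d hd
        simp only [mem_filter] at hd
        obtain ⟨_, l, rfl⟩ := hd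
        rw [Nat.mul_div_cancel_left l two_pos, Nat.mul_div_mul_left _ _ two_pos]
    · rw [filter_false_of_mem, sum_empty]
      exact fun d hd h => h2 (h.trans (Nat.dvd_of_mem_divisors hd))

theorem le_oddCodivisorSum (j : ℕ) : j ≤ oddCodivisorSum j := by
  cases j with
  | zero => exact Nat.zero_le _
  | succ j =>
    have h := single_le_sum (f := fun i => if 2 * i + 1 ∣ j + 1 then (j + 1) / (2 * i + 1) else 0)
      (fun _ _ => Nat.zero_le _) (mem_range.mpr (Nat.succ_pos j))
    rwa [mul_zero, zero_add, if_pos (one_dvd _), Nat.div_one] at h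

theorem two_mul_sum_oddCodivisorSum (x : ℕ) :
    2 * ∑ j ∈ range x, oddCodivisorSum (j + 1) =
      ∑ i ∈ range x, x / (2 * i + 1) * (x / (2 * i + 1) + 1) := by
  induction x with
  | zero => simp
  | succ x ih =>
    have hlast : x / (2 * x + 1) = 0 := Nat.div_eq_of_lt (by omega)
    rw [sum_range_succ, mul_add, ih, oddCodivisorSum, mul_sum]
    have hext : ∑ i ∈ range x, x / (2 * i + 1) * (x / (2 * i + 1) + 1) =
        ∑ i ∈ range (x + 1), x / (2 * i + 1) * (x / (2 * i + 1) + 1) := by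
      rw [sum_range_succ, hlast]; simp
    rw [hext, ← sum_add_distrib]
    refine sum_congr rfl fun i _ => ?_
    rw [Nat.succ_div]
    split_ifs <;> ring

theorem sum_inv_odd_sq_le (n : ℕ) :
    ∑ i ∈ range n, (1 : ℝ) / (2 * (i + 1 : ℕ) + 1) ^ 2 ≤ 1 / 4 - 1 / (4 * ((n : ℝ) + 1)) := by
  induction n with
  | zero => simp
  | succ n ih =>
    rw [sum_range_succ]
    have : (1 : ℝ) / (2 * (n + 1 : ℕ) + 1) ^ 2 ≤
        1 / (4 * (n + 1)) - 1 / (4 * ((n + 1 : ℕ) + 1)) := by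
      have hn : (0 : ℝ) ≤ n := n.cast_nonneg
      push_cast
      rw [div_sub_div _ _ (by positivity) (by positivity),
        div_le_div_iff₀ (by positivity) (by positivity)]
      nlinarith
    linarith

theorem two_mul_sum_oddCodivisorSum_le (x : ℕ) :
    2 * ∑ j ∈ range x, (oddCodivisorSum (j + 1) : ℝ) ≤ 3 / 2 * (x : ℝ) ^ 2 + x := by
  cases x with
  | zero => simp
  | succ m =>
    have h := congrArg (Nat.cast (R := ℝ)) (two_mul_sum_oddCodivisorSum (m + 1))
    rw [sum_range_succ' (fun i => _ / (2 * i + 1) * _)] at h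
    push_cast at h
    push_cast
    rw [h]
    have hterm : ∀ i ∈ range m,
        (((m + 1) / (2 * (i + 1) + 1) : ℕ) : ℝ) * ((((m + 1) / (2 * (i + 1) + 1) : ℕ) : ℝ) + 1) ≤
          2 * (m + 1 : ℝ) ^ 2 * (1 / (2 * (i + 1 : ℕ) + 1) ^ 2) := by
      intro i _
      have hdiv : (((m + 1) / (2 * (i + 1) + 1) : ℕ) : ℝ) ≤ (m + 1) / (2 * (i + 1 : ℕ) + 1) := by
        exact_mod_cast Nat.cast_div_le (α := ℝ) (m := m + 1) (n := 2 * (i + 1) + 1)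
      have hint : (((m + 1) / (2 * (i + 1) + 1) : ℕ) : ℝ) ≤
          (((m + 1) / (2 * (i + 1) + 1) : ℕ) : ℝ) ^ 2 := by
        exact_mod_cast Nat.le_self_pow two_ne_zero _
      have hsq := pow_le_pow_left₀ (Nat.cast_nonneg _) hdiv 2
      rw [div_pow] at hsq
      rw [mul_one_div, mul_div_assoc]
      nlinarith
    have hsum := sum_le_sum hterm
    rw [← mul_sum] at hsum
    have hinv : ∑ i ∈ range m, (1 : ℝ) / (2 * (i + 1 : ℕ) + 1) ^ 2 ≤ 1 / 4 :=
      (sum_inv_odd_sq_le m).trans (sub_le_self _ (by positivity))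
    have := mul_le_mul_of_nonneg_left hinv (by positivity : (0 : ℝ) ≤ 2 * (m + 1 : ℝ) ^ 2)
    norm_num at hsum this ⊢
    nlinarith

section Growth

variable {a : ℕ → ℝ}

theorem SatisfiesRec.backDiff_nonneg
    (h : SatisfiesRec (fun j => 2 * (oddCodivisorSum (j + 1) : ℝ)) a) (h0 : a 0 = 1) (n : ℕ) :
    0 ≤ _root_.backDiff a n := by
  refine h.backDiff.nonneg (fun j => ?_) (by simp [_root_.backDiff, h0]) n
  have : ((j + 1 : ℕ) : ℝ) ≤ oddCodivisorSum (j + 1) := Nat.cast_le.mpr (le_oddCodivisorSum _)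
  push_cast at this
  linarith [j.cast_nonneg (α := ℝ)]

theorem SatisfiesRec.backDiff_monotone
    (h : SatisfiesRec (fun j => 2 * (oddCodivisorSum (j + 1) : ℝ)) a) (h0 : a 0 = 1) :
    Monotone (_root_.backDiff a) := by
  refine monotone_of_backDiff_nonneg fun n =>
    h.backDiff.backDiff.nonneg (fun j => ?_) (by simp [_root_.backDiff, h0]) n
  have : ((j + 1 : ℕ) : ℝ) ≤ oddCodivisorSum (j + 1) := Nat.cast_le.mpr (le_oddCodivisorSum _)
  push_cast at this
  linarith [j.cast_nonneg (α := ℝ)]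

theorem SatisfiesRec.one_le
    (h : SatisfiesRec (fun j => 2 * (oddCodivisorSum (j + 1) : ℝ)) a) (h0 : a 0 = 1) (n : ℕ) :
    1 ≤ a n :=
  h0 ▸ monotone_of_backDiff_nonneg (h.backDiff_nonneg h0) n.zero_le

theorem SatisfiesRec.le_mul_sub
    (h : SatisfiesRec (fun j => 2 * (oddCodivisorSum (j + 1) : ℝ)) a) (h0 : a 0 = 1) (n : ℕ) :
    2 * ∑ k ∈ range (n + 1), a k - a n ≤ (n + 1) * (a (n + 1) - a n) := by
  have hrec := h.backDiff n
  rw [_root_.backDiff] at hrec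
  rw [hrec, ← sum_succ_mul_backDiff a n, ← sum_backDiff a n, mul_sum, ← sum_sub_distrib]
  refine sum_le_sum fun j _ => ?_
  rw [← mul_assoc, ← sub_one_mul]
  refine mul_le_mul_of_nonneg_right ?_ (h.backDiff_nonneg h0 _)
  have : ((j + 1 : ℕ) : ℝ) ≤ oddCodivisorSum (j + 1) := Nat.cast_le.mpr (le_oddCodivisorSum _)
  push_cast at this
  linarith

theorem sum_range_three_mul_add (x : ℕ) :
    ∑ j ∈ range x, (3 * (j + 1 : ℝ) - 1 / 2) = 3 / 2 * (x : ℝ) ^ 2 + x := by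
  induction x with
  | zero => simp
  | succ x ih => rw [sum_range_succ, ih]; push_cast; ring

theorem SatisfiesRec.mul_sub_le
    (h : SatisfiesRec (fun j => 2 * (oddCodivisorSum (j + 1) : ℝ)) a) (h0 : a 0 = 1) (n : ℕ) :
    (n + 1) * (a (n + 1) - a n) ≤ 3 * ∑ k ∈ range (n + 1), a k - 3 / 2 * a n := by
  have hrec := h.backDiff n
  rw [_root_.backDiff] at hrec
  have habel := sum_mul_nonneg_of_antitone
    (v := fun j => 3 * (j + 1 : ℝ) - 1 / 2 - 2 * (oddCodivisorSum (j + 1) : ℝ))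
    (f := fun j => _root_.backDiff a (n - j))
    (fun i j hij => h.backDiff_monotone h0 (Nat.sub_le_sub_left hij n))
    (fun j => h.backDiff_nonneg h0 _)
    (fun x => by
      rw [sum_sub_distrib, sum_range_three_mul_add, ← mul_sum]
      exact sub_nonneg.mpr (two_mul_sum_oddCodivisorSum_le x)) n
  rw [hrec, ← sum_succ_mul_backDiff a n, ← sum_backDiff a n, mul_sum, mul_sum, ← sub_nonneg,
    ← sum_sub_distrib, ← sum_sub_distrib]
  refine habel.trans_eq (sum_congr rfl fun j _ => ?_)
  ring

theorem sqrt_add_one_le {x : ℝ} (hx : 0 < x) : √(x + 1) ≤ √x + 1 / (2 * √x) := by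
  have hs := Real.sqrt_pos.mpr hx
  refine Real.sqrt_le_iff.mpr ⟨by positivity, ?_⟩
  have : (√x + 1 / (2 * √x)) ^ 2 = √x ^ 2 + 1 + (1 / (2 * √x)) ^ 2 := by field_simp; ring
  rw [this, Real.sq_sqrt hx.le]
  linarith [sq_nonneg (1 / (2 * √x))]

/-- A discrete Riccati comparison: `a(n)` is large compared with the preceding partial sum. -/
theorem SatisfiesRec.sum_range_le
    (h : SatisfiesRec (fun j => 2 * (oddCodivisorSum (j + 1) : ℝ)) a) (h0 : a 0 = 1) (n : ℕ)
    (hn : 1 ≤ n) : 7 / 5 * ∑ k ∈ range n, a k ≤ a n * √n := by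
  induction n, hn using Nat.le_induction with
  | base =>
    have h1 := h.le_mul_sub h0 0
    simp [h0] at h1 ⊢
    linarith
  | succ n hn ih =>
    have hlow := h.le_mul_sub h0 n
    have ha := h.one_le h0 n
    have hT : 0 ≤ ∑ k ∈ range n, a k := sum_nonneg fun k _ => zero_le_one.trans (h.one_le h0 k)
    rw [sum_range_succ] at hlow ⊢
    have hn' : (1 : ℝ) ≤ n := by exact_mod_cast hn
    have hsq := sqrt_add_one_le (zero_lt_one.trans_le hn')
    have hm1 : 1 ≤ √(n : ℝ) := Real.one_le_sqrt.mpr hn'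
    have hm2 : √(n : ℝ) ^ 2 = n := Real.sq_sqrt (by positivity)
    have hM2 : √(n + 1 : ℝ) ^ 2 = n + 1 := Real.sq_sqrt (by positivity)
    have hM0 : 0 < √(n + 1 : ℝ) := by positivity
    push_cast
    set T := ∑ k ∈ range n, a k
    set m := √(n : ℝ)
    set M := √(n + 1 : ℝ)
    have hMm : M * m ≤ m ^ 2 + 1 / 2 := by
      calc M * m ≤ (m + 1 / (2 * m)) * m := by gcongr
        _ = m ^ 2 + 1 / 2 := by field_simp
    have hkey : (7 / 5 * M - 2) * (T + a n) ≤ m ^ 2 * a n := by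
      rcases le_total (7 / 5 * M) 2 with hM | hM
      · have : (7 / 5 * M - 2) * (T + a n) ≤ 0 :=
          mul_nonpos_of_nonpos_of_nonneg (by linarith) (by linarith)
        exact this.trans (by positivity)
      · have hT' : T + a n ≤ a n * (5 / 7 * m + 1) := by linarith
        have hMlt : M ≤ m + 1 / 2 := hsq.trans (by gcongr; linarith)
        have hc : (7 / 5 * M - 2) * (5 / 7 * m + 1) ≤ m ^ 2 := by nlinarith
        calc (7 / 5 * M - 2) * (T + a n)
            ≤ (7 / 5 * M - 2) * (a n * (5 / 7 * m + 1)) :=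
              mul_le_mul_of_nonneg_left hT' (by linarith)
          _ = (7 / 5 * M - 2) * (5 / 7 * m + 1) * a n := by ring
          _ ≤ m ^ 2 * a n := by gcongr
    have hfin : 7 / 5 * (T + a n) * M ≤ a (n + 1) * M * M := by
      have : a (n + 1) * M * M = a (n + 1) * (n + 1) := by rw [mul_assoc, ← sq, hM2]
      rw [this]
      rw [hm2] at hkey
      linarith
    exact le_of_mul_le_mul_right hfin hM0

/-- The partial sums of `a` grow at least like `√n * exp (15 / 7 * √n)`. -/
theorem SatisfiesRec.exp_le_sum_range
    (h : SatisfiesRec (fun j => 2 * (oddCodivisorSum (j + 1) : ℝ)) a) (h0 : a 0 = 1)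
    (hbase : √(64 : ℝ) * Real.exp (15 / 7 * √64 + 3 / 2) ≤ 7 / 5 * ∑ k ∈ range 64, a k)
    (n : ℕ) (hn : 64 ≤ n) :
    √(n : ℝ) * Real.exp (15 / 7 * √n + 3 / 2) ≤ 7 / 5 * ∑ k ∈ range n, a k := by
  induction n, hn using Nat.le_induction with
  | base => exact_mod_cast hbase
  | succ n hn ih =>
    have hric := h.sum_range_le h0 n (by omega)
    rw [sum_range_succ]
    have hn' : (64 : ℝ) ≤ n := by exact_mod_cast hn
    have hsq := sqrt_add_one_le (lt_of_lt_of_le (by norm_num) hn')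
    have hm8 : 8 ≤ √(n : ℝ) := Real.le_sqrt_of_sq_le (by linarith)
    push_cast
    set T := ∑ k ∈ range n, a k
    set m := √(n : ℝ)
    have hm : 0 < m := by linarith
    obtain ⟨x, hx⟩ : ∃ x, x = 1 / m := ⟨_, rfl⟩
    have hmx : m * x = 1 := by rw [hx]; field_simp
    have hx0 : 0 < x := by rw [hx]; positivity
    have hx8 : x ≤ 1 / 8 := by rw [hx]; exact one_div_le_one_div_of_le (by norm_num) hm8
    have hsq' : √(n + 1 : ℝ) ≤ m + x / 2 := hsq.trans_eq (by rw [hx]; ring)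
    have hexp : Real.exp (15 / 14 * x) ≤ 1 + 15 / 14 * x + (15 / 14 * x) ^ 2 := by
      have := Real.abs_exp_sub_one_sub_id_le (x := 15 / 14 * x)
        (by rw [abs_of_pos (by positivity)]; linarith)
      linarith [le_abs_self (Real.exp (15 / 14 * x) - 1 - 15 / 14 * x)]
    have hfactor : (1 + x ^ 2 / 2) * Real.exp (15 / 14 * x) ≤ 1 + 7 / 5 * x := by
      calc (1 + x ^ 2 / 2) * Real.exp (15 / 14 * x)
          ≤ (1 + x ^ 2 / 2) * (1 + 15 / 14 * x + (15 / 14 * x) ^ 2) := by gcongr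
        _ ≤ 1 + 7 / 5 * x := by
            have h2 : x ^ 2 ≤ x / 8 := by nlinarith
            have h3 : x ^ 3 ≤ x / 64 := by nlinarith
            have h4 : x ^ 4 ≤ x / 512 := by nlinarith
            nlinarith
    have haT : 7 / 5 * T * x ≤ a n := by
      calc 7 / 5 * T * x ≤ a n * m * x := by gcongr
        _ = a n := by rw [mul_assoc, hmx, mul_one]
    calc √(n + 1 : ℝ) * Real.exp (15 / 7 * √(n + 1 : ℝ) + 3 / 2)
        ≤ (m + x / 2) * Real.exp (15 / 7 * (m + x / 2) + 3 / 2) := by gcongr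
      _ = m * Real.exp (15 / 7 * m + 3 / 2) * ((1 + x ^ 2 / 2) * Real.exp (15 / 14 * x)) := by
          rw [show 15 / 7 * (m + x / 2) + 3 / 2 = 15 / 7 * m + 3 / 2 + 15 / 14 * x by ring,
            Real.exp_add]
          have : m + x / 2 = m * (1 + x ^ 2 / 2) := by linear_combination (-x / 2) * hmx
          rw [this]; ring
      _ ≤ 7 / 5 * T * (1 + 7 / 5 * x) :=
          mul_le_mul ih hfactor (by positivity) (le_trans (by positivity) ih)
      _ ≤ 7 / 5 * (T + a n) := by linarith

theorem SatisfiesRec.pow_succ_lt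
    (h : SatisfiesRec (fun j => 2 * (oddCodivisorSum (j + 1) : ℝ)) a) (h0 : a 0 = 1)
    (hbase : √(64 : ℝ) * Real.exp (15 / 7 * √64 + 3 / 2) ≤ 7 / 5 * ∑ k ∈ range 64, a k)
    (n : ℕ) (hn : 64 ≤ n) : a (n + 1) ^ n < a n ^ (n + 1) := by
  have hric := h.sum_range_le h0 n (by omega)
  have hup := h.mul_sub_le h0 n
  have ha := h.one_le h0 n
  have ha' := h.one_le h0 (n + 1)
  have hm : 0 < √(n : ℝ) := Real.sqrt_pos.mpr (by exact_mod_cast (by omega : 0 < n))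
  have hexp : Real.exp (15 / 7 * √n + 3 / 2) ≤ a n := by
    refine le_of_mul_le_mul_left ?_ hm
    linarith [h.exp_le_sum_range h0 hbase n hn]
  rw [sum_range_succ] at hup
  set m := √(n : ℝ)
  obtain ⟨r, hr⟩ : ∃ r, r = (15 / 7 * m + 3 / 2) / (n + 1) := ⟨_, rfl⟩
  have hr0 : 0 < r := by rw [hr]; positivity
  have hrn : (n + 1) * r = 15 / 7 * m + 3 / 2 := by rw [hr]; field_simp
  have hratio : a (n + 1) ≤ a n * Real.exp r := by
    have h1 : a (n + 1) ≤ a n * (r + 1) := by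
      refine le_of_mul_le_mul_left ?_ (by positivity : (0 : ℝ) < n + 1)
      have : (n + 1) * (a n * (r + 1)) = a n * (15 / 7 * m + 3 / 2) + (n + 1) * a n := by
        rw [← hrn]; ring
      linarith
    exact h1.trans (mul_le_mul_of_nonneg_left (Real.add_one_le_exp r) (by linarith))
  calc a (n + 1) ^ n ≤ (a n * Real.exp r) ^ n := by gcongr
    _ = a n ^ n * Real.exp (n * r) := by rw [mul_pow, ← Real.exp_nat_mul]
    _ < a n ^ n * Real.exp (15 / 7 * m + 3 / 2) := by
        gcongr
        linarith
    _ ≤ a n ^ n * a n := by gcongr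
    _ = a n ^ (n + 1) := (pow_succ _ _).symm

end Growth

/-- The overpartition numbers `p̄(0), …, p̄(64)`. -/
def overpartitionTable (n : ℕ) : ℕ :=
  [1, 2, 4, 8, 14, 24, 40, 64, 100, 154, 232, 344, 504, 728, 1040, 1472, 2062, 2864, 3948, 5400,
    7336, 9904, 13288, 17728, 23528, 31066, 40824, 53408, 69568, 90248, 116624, 150144, 192612,
    246256, 313808, 398640, 504886, 637592, 802936, 1008448, 1263272, 1578528, 1967696, 2447064,
    3036328, 3759240, 4644368, 5726080, 7045624, 8652402, 10605564, 12975792, 15847400, 19320904,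
    23515936, 28574656, 34665872, 41989744, 50783272, 61326856, 73951808, 89049096, 107079712,
    128586560, 154208270].getD n 0

theorem overpartitionTable_rec : ∀ n < 64, (n + 1) * overpartitionTable (n + 1) =
    ∑ j ∈ range (n + 1), 2 * oddCodivisorSum (j + 1) * overpartitionTable (n - j) := by
  decide +kernel

theorem overpartitionTable_pow_lt : ∀ n < 64, 3 ≤ n →
    overpartitionTable (n + 1) ^ n < overpartitionTable n ^ (n + 1) := by
  decide +kernel

theorem SatisfiesRec.eq_overpartitionTable {a : ℕ → ℝ}
    (h : SatisfiesRec (fun j => 2 * (oddCodivisorSum (j + 1) : ℝ)) a) (h0 : a 0 = 1) (n : ℕ)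
    (hn : n ≤ 64) : a n = overpartitionTable n := by
  induction n using Nat.strong_induction_on with
  | _ n ih =>
    cases n with
    | zero => simp [h0, overpartitionTable]
    | succ n =>
      have ht := congrArg (Nat.cast (R := ℝ)) (overpartitionTable_rec n (by omega))
      push_cast at ht
      refine mul_left_cancel₀ (by positivity : (n + 1 : ℝ) ≠ 0) ((h n).trans (.trans ?_ ht.symm))
      exact sum_congr rfl fun j _ => by rw [ih (n - j) (by omega) (by omega)]

theorem exp_le_sum_overpartitionTable :
    √(64 : ℝ) * Real.exp (15 / 7 * √64 + 3 / 2) ≤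
      7 / 5 * ((∑ k ∈ range 64, overpartitionTable k : ℕ) : ℝ) := by
  have hsqrt : √(64 : ℝ) = 8 := by
    rw [show (64 : ℝ) = 8 ^ 2 by norm_num]; exact Real.sqrt_sq (by norm_num)
  have hsum : ∑ k ∈ range 64, overpartitionTable k = 743141623 := by decide +kernel
  have hexp : Real.exp (261 / 14) ≤ 128000000 := by
    have hnine : Real.exp 9 ≤ 8104 := by
      rw [show (9 : ℝ) = (9 : ℕ) * 1 by norm_num, Real.exp_nat_mul]
      exact (pow_le_pow_left₀ (Real.exp_pos _).le Real.exp_one_lt_d9.le _).trans (by norm_num)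
    refine le_of_pow_le_pow_left₀ (n := 14) (by norm_num) (by norm_num) ?_
    rw [← Real.exp_nat_mul, show ((14 : ℕ) : ℝ) * (261 / 14) = (29 : ℕ) * 9 by norm_num,
      Real.exp_nat_mul]
    exact (pow_le_pow_left₀ (Real.exp_pos _).le hnine _).trans (by norm_num)
  rw [hsqrt, hsum, show (15 / 7 * 8 + 3 / 2 : ℝ) = 261 / 14 by norm_num]
  push_cast
  linarith

theorem satisfiesRec_of_sum_Icc (pbar : ℕ → ℚ)
    (hrec : ∀ n : ℕ, 1 ≤ n →
      (n : ℚ) * pbar n = 2 * ∑ j ∈ Icc 1 n,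
        ((∑ d ∈ j.divisors, (d : ℚ)) - if 2 ∣ j then ∑ d ∈ (j / 2).divisors, (d : ℚ) else 0) *
          pbar (n - j)) :
    SatisfiesRec (fun j => 2 * (oddCodivisorSum (j + 1) : ℝ)) (fun n => (pbar n : ℝ)) := by
  intro n
  have hg : ∀ j : ℕ, 1 ≤ j → (∑ d ∈ j.divisors, (d : ℚ)) -
      (if 2 ∣ j then ∑ d ∈ (j / 2).divisors, (d : ℚ) else 0) = oddCodivisorSum j := by
    intro j hj
    have := congrArg (Nat.cast (R := ℚ)) (sum_divisors_eq_oddCodivisorSum_add hj)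
    push_cast at this
    exact sub_eq_of_eq_add this
  have hn := hrec (n + 1) n.succ_pos
  rw [← Finset.Ico_add_one_right_eq_Icc, sum_Ico_eq_sum_range, mul_sum] at hn
  have hQ : ((n + 1 : ℕ) : ℚ) * pbar (n + 1) =
      ∑ j ∈ range (n + 1), 2 * (oddCodivisorSum (j + 1) : ℚ) * pbar (n - j) := by
    refine hn.trans (sum_congr rfl fun j _ => ?_)
    rw [hg _ (Nat.le_add_right 1 j), add_comm 1 j, Nat.add_sub_add_right, mul_assoc]
  have hR := congrArg (Rat.cast (K := ℝ)) hQ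
  push_cast at hR
  exact hR

/-- For the overpartition numbers `p̄(n)`, characterized by the recursion
`n·p̄(n) = 2∑_{j=1}^n ḡ(j)p̄(n−j)` with `ḡ(j) = σ(j) − σ(j/2)` and `p̄(0)=1`:
`p̄(1)² = p̄(2)`, `p̄(2)³ = p̄(3)²`, and `p̄(n)^(n+1) > p̄(n+1)^n` for all `n ≥ 3`. -/
theorem overpartition_root_inequality (pbar : ℕ → ℚ)
    (hp0 : pbar 0 = 1)
    (hrec : ∀ n : ℕ, 1 ≤ n →
      (n : ℚ) * pbar n = 2 * ∑ j ∈ Icc 1 n,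
        ((∑ d ∈ j.divisors, (d : ℚ)) - if 2 ∣ j then ∑ d ∈ (j / 2).divisors, (d : ℚ) else 0) *
          pbar (n - j)) :
    pbar 1 ^ 2 = pbar 2 ∧ pbar 2 ^ 3 = pbar 3 ^ 2 ∧
    ∀ n : ℕ, 3 ≤ n → pbar n ^ (n + 1) > pbar (n + 1) ^ n := by
  have h := satisfiesRec_of_sum_Icc pbar hrec
  have h0 : (pbar 0 : ℝ) = 1 := by exact_mod_cast hp0
  have htab : ∀ n ≤ 64, pbar n = overpartitionTable n := fun n hn => by
    exact_mod_cast h.eq_overpartitionTable h0 n hn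
  refine ⟨?_, ?_, fun n hn => ?_⟩
  · rw [htab 1 (by norm_num), htab 2 (by norm_num)]
    norm_num [overpartitionTable]
  · rw [htab 2 (by norm_num), htab 3 (by norm_num)]
    norm_num [overpartitionTable]
  · rcases lt_or_ge n 64 with hlt | hge
    · rw [htab n hlt.le, htab (n + 1) hlt]
      exact_mod_cast overpartitionTable_pow_lt n hlt hn
    · have hbase := exp_le_sum_overpartitionTable
      push_cast at hbase
      rw [← sum_congr rfl fun k hk => h.eq_overpartitionTable h0 k (mem_range.mp hk).le] at hbase
      exact_mod_cast h.pow_succ_lt h0 hbase n hge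
end
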